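/- If each factor of an aperiodic recurrent infinite binary word w has at most three abelian returns, then one of the two letters is isolated in w, i.e., either 00 or 11 is not a factor of w. -/

import Mathlib

variable {α : Type*}

/-- The factor of the infinite word `w` of length `n` starting at position `i`. -/
def factorAt (w : ℕ → α) (i n : ℕ) : List α :=
  (List.range n).map fun k => w (i + k)

/-- `u` is a factor of the infinite word `w`. -/
def IsFactor (w : ℕ → α) (u : List α) : Prop :=
  ∃ i, factorAt w i u.length = u

/-- `w` is recurrent: each of its factors occurs infinitely many times. -/
def Recurrent (w : ℕ → α) : Prop :=
  ∀ u : List α, IsFactor w u → ∀ N : ℕ, ∃ i, N ≤ i ∧ factorAt w i u.length = u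

/-- `w` is periodic: there is `T > 0` with `w (n + T) = w n` for all `n`. -/
def Periodic (w : ℕ → α) : Prop :=
  ∃ T : ℕ, 0 < T ∧ ∀ n, w (n + T) = w n

def Aperiodic (w : ℕ → α) : Prop := ¬ Periodic w

def UltimatelyPeriodic (w : ℕ → α) : Prop :=
  ∃ N T : ℕ, 0 < T ∧ ∀ n, N ≤ n → w (n + T) = w n

/-- `w` is Sturmian: aperiodic with subword complexity `n + 1`. -/
def Sturmian (w : ℕ → α) : Prop :=
  Aperiodic w ∧ ∀ n : ℕ, {u : List α | u.length = n ∧ IsFactor w u}.ncard = n + 1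

/-- Positions where `u` occurs in `w`. -/
def Occurrences (w : ℕ → α) (u : List α) : Set ℕ :=
  {i | factorAt w i u.length = u}

/-- The return words of `u` in `w`: words from one occurrence of `u` to the next. -/
def ReturnWords (w : ℕ → α) (u : List α) : Set (List α) :=
  {r | ∃ i j : ℕ, i ∈ Occurrences w u ∧ j ∈ Occurrences w u ∧ i < j ∧
    (∀ k, i < k → k < j → k ∉ Occurrences w u) ∧ r = factorAt w i (j - i)}

/-- Positions where a word abelian-equivalent to `u` occurs in `w`. -/
def AbelianOccurrences (w : ℕ → α) (u : List α) : Set ℕ :=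
  {i | List.Perm (factorAt w i u.length) u}

/-- The abelian return words of `u` in `w`. -/
def AbelianReturnWords (w : ℕ → α) (u : List α) : Set (List α) :=
  {r | ∃ i j : ℕ, i ∈ AbelianOccurrences w u ∧ j ∈ AbelianOccurrences w u ∧ i < j ∧
    (∀ k, i < k → k < j → k ∉ AbelianOccurrences w u) ∧ r = factorAt w i (j - i)}

/-- The abelian equivalence classes (as multisets) of the abelian return words of `u` in `w`. -/
def abelianReturnClasses (w : ℕ → α) (u : List α) : Set (Multiset α) :=
  (fun r : List α => (r : Multiset α)) '' AbelianReturnWords w u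

def RightSpecial (w : ℕ → α) (u : List α) : Prop :=
  ∃ a b : α, a ≠ b ∧ IsFactor w (u ++ [a]) ∧ IsFactor w (u ++ [b])

def LeftSpecial (w : ℕ → α) (u : List α) : Prop :=
  ∃ a b : α, a ≠ b ∧ IsFactor w (a :: u) ∧ IsFactor w (b :: u)

def Bispecial (w : ℕ → α) (u : List α) : Prop :=
  RightSpecial w u ∧ LeftSpecial w u

/-- A factor is singular if it is the only factor of `w` in its abelian class. -/
def Singular (w : ℕ → α) (u : List α) : Prop :=
  ∀ v : List α, IsFactor w v → List.Perm v u → v = u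

/-- `w` is an infinite concatenation of words from `S`. -/
def InfConcat (S : Set (List α)) (w : ℕ → α) : Prop :=
  ∃ f : ℕ → List α, (∀ n, f n ∈ S) ∧
    ∀ n, factorAt w (((List.range n).map fun k => (f k).length).sum) (f n).length = f n

/-- A finite binary word is balanced if any two factors of equal length have numbers
of occurrences of `true` differing by at most one. -/
def BalancedList (w : List Bool) : Prop :=
  ∀ u v : List Bool, u <:+: w → v <:+: w → u.length = v.length →
    |(u.count true : ℤ) - (v.count true : ℤ)| ≤ 1


/-- Number of letters `true` among the `n` letters of `x` from position `p` on. -/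
def cnt (x : ℕ → Bool) (p n : ℕ) : ℕ :=
  ∑ t ∈ Finset.range n, (x (p + t)).toNat

@[simp] theorem cnt_zero (x : ℕ → Bool) (p : ℕ) : cnt x p 0 = 0 := by simp [cnt]

theorem cnt_succ (x : ℕ → Bool) (p n : ℕ) : cnt x p (n + 1) = cnt x p n + (x (p + n)).toNat := by
  simp [cnt, Finset.sum_range_succ]

theorem cnt_add (x : ℕ → Bool) (p m n : ℕ) : cnt x p (m + n) = cnt x p m + cnt x (p + m) n := by
  simp [cnt, Finset.sum_range_add, add_assoc]

theorem cnt_le (x : ℕ → Bool) (p n : ℕ) : cnt x p n ≤ n := by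
  induction n with
  | zero => simp
  | succ n ih => rw [cnt_succ]; have := Bool.toNat_le (x (p + n)); omega

theorem cnt_not (x : ℕ → Bool) (p n : ℕ) : cnt (fun i => !x i) p n + cnt x p n = n := by
  induction n with
  | zero => simp
  | succ n ih =>
    rw [cnt_succ, cnt_succ]
    cases x (p + n) <;> simp <;> omega

theorem cnt_const {x : ℕ → Bool} {b : Bool} {p n : ℕ} (h : ∀ t < n, x (p + t) = b) :
    cnt x p n = n * b.toNat := by
  unfold cnt
  rw [Finset.sum_congr rfl (fun t ht => by rw [h t (Finset.mem_range.1 ht)])]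
  simp

/-- Consecutive positions `i` and `i + d` at which the windows of length `n` have weight `c`. -/
structure Ret (x : ℕ → Bool) (n c i d : ℕ) : Prop where
  pos : 0 < d
  start : cnt x i n = c
  finish : cnt x (i + d) n = c
  mid : ∀ e, 0 < e → e < d → cnt x (i + e) n ≠ c

/-- Some return for windows of length `n` and weight `c` has length `d` and weight `o`. -/
def Cls (x : ℕ → Bool) (n c d o : ℕ) : Prop :=
  ∃ i, Ret x n c i d ∧ cnt x i d = o

/-- For no window length and weight are there four returns with distinct length and weight. -/
def NoFour (x : ℕ → Bool) : Prop :=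
  ∀ n c d₁ o₁ d₂ o₂ d₃ o₃ d₄ o₄,
    Cls x n c d₁ o₁ → Cls x n c d₂ o₂ → Cls x n c d₃ o₃ → Cls x n c d₄ o₄ →
      (d₁ = d₂ ∧ o₁ = o₂) ∨ (d₁ = d₃ ∧ o₁ = o₃) ∨ (d₁ = d₄ ∧ o₁ = o₄) ∨
      (d₂ = d₃ ∧ o₂ = o₃) ∨ (d₂ = d₄ ∧ o₂ = o₄) ∨ (d₃ = d₄ ∧ o₃ = o₄)

theorem Cls.compl {x : ℕ → Bool} {n c d o : ℕ} (h : Cls x n c d o) :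
    Cls (fun i => !x i) n (n - c) d (d - o) := by
  obtain ⟨i, h, ho⟩ := h
  refine ⟨i, ⟨h.pos, ?_, ?_, fun e h0 h1 => ?_⟩, ?_⟩
  · have := cnt_not x i n; have := h.start; omega
  · have := cnt_not x (i + d) n; have := h.finish; omega
  · have := cnt_not x (i + e) n; have := h.mid e h0 h1
    have := cnt_not x i n; have := h.start; omega
  · have := cnt_not x i d; omega

theorem Cls.le {x : ℕ → Bool} {n c d o : ℕ} (h : Cls x n c d o) : o ≤ d := by
  obtain ⟨i, -, rfl⟩ := h; exact cnt_le _ _ _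

theorem NoFour.compl {x : ℕ → Bool} (h : NoFour x) : NoFour fun i => !x i := by
  intro n c d₁ o₁ d₂ o₂ d₃ o₃ d₄ o₄ h₁ h₂ h₃ h₄
  have l₁ := h₁.le
  have l₂ := h₂.le
  have l₃ := h₃.le
  have l₄ := h₄.le
  have k₁ := h₁.compl
  have k₂ := h₂.compl
  have k₃ := h₃.compl
  have k₄ := h₄.compl
  simp only [Bool.not_not] at k₁ k₂ k₃ k₄
  have key : ∀ {d o d' o' : ℕ}, o ≤ d → o' ≤ d' → (d = d' ∧ d - o = d' - o') →
      (d = d' ∧ o = o') := by omega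
  exact (h _ _ _ _ _ _ _ _ _ _ k₁ k₂ k₃ k₄).imp (key l₁ l₂) <| Or.imp (key l₁ l₃) <|
    Or.imp (key l₁ l₄) <| Or.imp (key l₂ l₃) <| Or.imp (key l₂ l₄) (key l₃ l₄)

/-- A maximal block of `k ≥ 1` letters `b`, preceded by the other letter at position `p`. -/
structure Run (x : ℕ → Bool) (b : Bool) (p k : ℕ) : Prop where
  pos : 1 ≤ k
  left : x p = !b
  mid : ∀ t < k, x (p + 1 + t) = b
  right : x (p + 1 + k) = !b

theorem UltimatelyPeriodic.compl {x : ℕ → Bool} (h : UltimatelyPeriodic fun i => !x i) :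
    UltimatelyPeriodic x := by
  obtain ⟨N, T, hT, h⟩ := h
  exact ⟨N, T, hT, fun n hn => by simpa using h n hn⟩

theorem exists_ge_eq {x : ℕ → Bool} (h : ¬ UltimatelyPeriodic x) (b : Bool) (N : ℕ) :
    ∃ p, N ≤ p ∧ x p = b := by
  by_contra! hc
  refine h ⟨N, 1, one_pos, fun n hn => ?_⟩
  have h1 := hc n hn
  have h2 := hc (n + 1) (by omega)
  revert h1 h2
  cases x n <;> cases x (n + 1) <;> cases b <;> simp

/-- A position where `b` starts is the start of a maximal block of letters `b`. -/
theorem exists_run_of {x : ℕ → Bool} (h : ¬ UltimatelyPeriodic x) {b : Bool} {p : ℕ} (h0 : x p = !b)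
    (h1 : x (p + 1) = b) : ∃ k, Run x b p k := by
  classical
  have hex : ∃ k, x (p + 1 + k) = !b := by
    obtain ⟨q, hq, hb⟩ := exists_ge_eq h (!b) (p + 1)
    exact ⟨q - (p + 1), by rw [show p + 1 + (q - (p + 1)) = q by omega]; exact hb⟩
  refine ⟨Nat.find hex, ?_, h0, fun t ht => ?_, Nat.find_spec hex⟩
  · rcases Nat.eq_zero_or_pos (Nat.find hex) with h2 | h2
    · have := Nat.find_spec hex
      rw [h2, add_zero, h1] at this
      cases b <;> simp at this
    · exact h2
  · have := Nat.find_min hex ht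
    revert this
    cases x (p + 1 + t) <;> cases b <;> simp

/-- Runs of both letters occur arbitrarily far. -/
theorem exists_run_ge {x : ℕ → Bool} (h : ¬ UltimatelyPeriodic x) (b : Bool) (N : ℕ) :
    ∃ p k, N ≤ p ∧ Run x b p k := by
  classical
  obtain ⟨q, hq, h0⟩ := exists_ge_eq h (!b) N
  have hex : ∃ k, x (q + k) = b := by
    obtain ⟨r, hr, hb⟩ := exists_ge_eq h b q
    exact ⟨r - q, by rw [show q + (r - q) = r by omega]; exact hb⟩
  obtain ⟨m, hm⟩ : ∃ m, Nat.find hex = m + 1 := by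
    rcases hf : Nat.find hex with _ | m
    · have := Nat.find_spec hex
      rw [hf, add_zero, h0] at this
      cases b <;> simp at this
    · exact ⟨m, rfl⟩
  have h1 : x (q + m) = !b := by
    have := Nat.find_min hex (m := m) (by omega)
    revert this
    cases x (q + m) <;> cases b <;> simp
  have h2 : x (q + m + 1) = b := by
    have := Nat.find_spec hex
    rwa [hm] at this
  obtain ⟨k, hk⟩ := exists_run_of h h1 h2
  exact ⟨q + m, k, by omega, hk⟩

/-- After a run of `b` there is a run of the other letter. -/
theorem Run.next {x : ℕ → Bool} (h : ¬ UltimatelyPeriodic x) {b : Bool} {p k : ℕ}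
    (hr : Run x b p k) :
    ∃ l, Run x (!b) (p + k) l := by
  have h1 := hr.mid (k - 1) (by have := hr.pos; omega)
  rw [show p + 1 + (k - 1) = p + k by have := hr.pos; omega] at h1
  refine exists_run_of h (by simpa using h1) ?_
  rw [show p + k + 1 = p + 1 + k by omega]; exact hr.right

theorem Run.compl {x : ℕ → Bool} {b : Bool} {p k : ℕ} (h : Run (fun i => !x i) b p k) :
    Run x (!b) p k :=
  ⟨h.pos, by have := h.left; revert this; cases x p <;> cases b <;> simp,
    fun t ht => by have := h.mid t ht; revert this; cases x (p + 1 + t) <;> cases b <;> simp,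
    by have := h.right; revert this; cases x (p + 1 + k) <;> cases b <;> simp⟩

/-- In a word that is not ultimately periodic, some letter has runs of two lengths. -/
theorem exists_two_runs {x : ℕ → Bool} (h : ¬ UltimatelyPeriodic x) :
    ∃ b p k q l, k < l ∧ Run x b p k ∧ Run x b q l := by
  by_contra! hc
  have huniq : ∀ b p k q l, Run x b p k → Run x b q l → k = l := by
    intro b p k q l h1 h2
    rcases lt_trichotomy k l with h3 | h3 | h3
    · exact absurd h2 (hc b p k q l h3 h1)
    · exact h3
    · exact absurd h1 (hc b q l p k h3 h2)
  obtain ⟨p, k, -, hp⟩ := exists_run_ge h false 0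
  obtain ⟨l, hl⟩ := hp.next h
  have hstep : ∀ q, Run x false q k → (∀ t < k + l, x (q + (k + l) + t) = x (q + t)) ∧
      Run x false (q + (k + l)) k := by
    intro q hq
    obtain ⟨l', hl'⟩ := hq.next h
    obtain rfl := huniq _ _ _ _ _ hl hl'
    obtain ⟨k', hk'⟩ := hl'.next h
    obtain rfl := huniq _ _ _ _ _ hq hk'
    rw [← add_assoc]
    refine ⟨fun t ht => ?_, hk'⟩
    rcases Nat.eq_zero_or_pos t with rfl | h0
    · have h1 := hq.left
      have h2 := hk'.left
      simp only [add_zero]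
      rw [h2, h1]; simp
    rcases Nat.lt_or_ge k t with h3 | h3
    · have h1 : x (q + t) = true := by
        have := hl'.mid (t - (k + 1)) (by omega)
        rwa [show q + k + 1 + (t - (k + 1)) = q + t by omega] at this
      obtain ⟨l', hl''⟩ := hk'.next h
      obtain rfl := huniq _ _ _ _ _ hl hl''
      have h2 := hl''.mid (t - (k + 1)) (by omega)
      rw [show q + k + l + k + 1 + (t - (k + 1)) = q + k + l + t by omega] at h2
      simp at h2
      rw [h1, h2]
    · have h1 := hq.mid (t - 1) (by omega)
      have h2 := hk'.mid (t - 1) (by omega)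
      rw [show q + 1 + (t - 1) = q + t by omega] at h1
      rw [show q + k + l + 1 + (t - 1) = q + k + l + t by omega] at h2
      rw [h1, h2]; simp
  have hall : ∀ m, Run x false (p + m * (k + l)) k := by
    intro m
    induction m with
    | zero => simpa using hp
    | succ m ih =>
      rw [show p + (m + 1) * (k + l) = p + m * (k + l) + (k + l) by ring]
      exact (hstep _ ih).2
  have hkl : 0 < k + l := by have := hp.pos; omega
  refine h ⟨p, k + l, hkl, fun n hn => ?_⟩
  have h1 := (hstep _ (hall ((n - p) / (k + l)))).1 ((n - p) % (k + l)) (Nat.mod_lt _ hkl)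
  have h2 : p + (n - p) / (k + l) * (k + l) + (n - p) % (k + l) = n := by
    have := Nat.div_add_mod' (n - p) (k + l)
    omega
  rw [h2, add_right_comm, h2] at h1
  exact h1

theorem count_factorAt (w : ℕ → Bool) (i n : ℕ) : (factorAt w i n).count true = cnt w i n := by
  induction n with
  | zero => simp [factorAt]
  | succ n ih =>
    rw [cnt_succ, ← ih]
    unfold factorAt
    rw [List.range_succ, List.map_append, List.count_append]
    cases h : w (i + n) <;> simp [h]

theorem length_factorAt (w : ℕ → Bool) (i n : ℕ) : (factorAt w i n).length = n := by
  simp [factorAt]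

theorem perm_factorAt_iff (w : ℕ → Bool) (i j n : ℕ) :
    (factorAt w i n).Perm (factorAt w j n) ↔ cnt w i n = cnt w j n := by
  refine ⟨fun h => ?_, fun h => ?_⟩
  · rw [← count_factorAt, ← count_factorAt]; exact h.count_eq true
  · rw [List.perm_iff_count]
    have h1 := List.count_false_add_count_true (factorAt w i n)
    have h2 := List.count_false_add_count_true (factorAt w j n)
    rw [length_factorAt, count_factorAt] at h1 h2
    rintro (_ | _)
    · omega
    · rw [count_factorAt, count_factorAt]; exact h

theorem four_le_encard {β : Type*} {S : Set β} {a b c d : β} (ha : a ∈ S) (hb : b ∈ S)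
    (hc : c ∈ S) (hd : d ∈ S) (hab : a ≠ b) (hac : a ≠ c) (had : a ≠ d) (hbc : b ≠ c)
    (hbd : b ≠ d) (hcd : c ≠ d) : ¬ S.encard ≤ 3 := by
  intro h
  have hsub : ({a, b, c, d} : Set β) ⊆ S := by
    rintro x (rfl | rfl | rfl | rfl) <;> assumption
  have h4 : ({a, b, c, d} : Set β).encard = 4 := by
    rw [Set.encard_insert_of_notMem (by simp [hab, hac, had]),
      Set.encard_insert_of_notMem (by simp [hbc, hbd]), Set.encard_pair hcd]
    norm_num
  have := (Set.encard_le_encard hsub).trans h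
  rw [h4] at this
  exact absurd this (by decide)

theorem noFour_of_encard_le {w : ℕ → Bool}
    (h : ∀ u : List Bool, IsFactor w u → (abelianReturnClasses w u).encard ≤ 3) : NoFour w := by
  intro n c d₁ o₁ d₂ o₂ d₃ o₃ d₄ o₄ h₁ h₂ h₃ h₄
  obtain ⟨i₁, r₁, e₁⟩ := h₁
  obtain ⟨i₂, r₂, e₂⟩ := h₂
  obtain ⟨i₃, r₃, e₃⟩ := h₃
  obtain ⟨i₄, r₄, e₄⟩ := h₄
  have hu := h (factorAt w i₁ n) ⟨i₁, by rw [length_factorAt]⟩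
  have hocc : ∀ i, i ∈ AbelianOccurrences w (factorAt w i₁ n) ↔ cnt w i n = c := by
    intro i
    simp only [AbelianOccurrences, Set.mem_ofPred_eq, length_factorAt, perm_factorAt_iff, r₁.start]
  have hmem : ∀ {i d}, Ret w n c i d →
      (factorAt w i d : Multiset Bool) ∈ abelianReturnClasses w (factorAt w i₁ n) := by
    intro i d r
    refine ⟨_, ⟨i, i + d, (hocc i).2 r.start, (hocc _).2 r.finish, by have := r.pos; omega,
      fun k h1 h2 => ?_, rfl⟩, by simp⟩
    rw [hocc]
    have := r.mid (k - i) (by omega) (by omega)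
    rwa [show i + (k - i) = k by omega] at this
  have heq : ∀ {i d i' d'}, (factorAt w i d : Multiset Bool) = factorAt w i' d' →
      d = d' ∧ cnt w i d = cnt w i' d' := by
    intro i d i' d' h
    have h := Multiset.coe_eq_coe.1 h
    refine ⟨?_, ?_⟩
    · simpa [length_factorAt] using h.length_eq
    · rw [← count_factorAt, ← count_factorAt]; exact h.count_eq true
  subst e₁ e₂ e₃ e₄
  by_contra! hne
  refine four_le_encard (hmem r₁) (hmem r₂) (hmem r₃) (hmem r₄)
    (fun h => hne.1 (heq h).1 (heq h).2) (fun h => hne.2.1 (heq h).1 (heq h).2)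
    (fun h => hne.2.2.1 (heq h).1 (heq h).2) (fun h => hne.2.2.2.1 (heq h).1 (heq h).2)
    (fun h => hne.2.2.2.2.1 (heq h).1 (heq h).2)
    (fun h => hne.2.2.2.2.2 (heq h).1 (heq h).2) hu

/-- Every position recurs: the word seen from there agrees on any prefix. -/
theorem Recurrent.exists_ge {w : ℕ → Bool} (h : Recurrent w) (i n N : ℕ) :
    ∃ j, N ≤ j ∧ ∀ t < n, w (j + t) = w (i + t) := by
  obtain ⟨j, hj, e⟩ := h (factorAt w i n) ⟨i, by rw [length_factorAt]⟩ N
  refine ⟨j, hj, fun t ht => ?_⟩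
  rw [length_factorAt] at e
  have := congrArg (fun l : List Bool => l[t]?) e
  simpa [factorAt, ht] using this

theorem Recurrent.not_ultimatelyPeriodic {w : ℕ → Bool} (h : Recurrent w) (ha : Aperiodic w) :
    ¬ UltimatelyPeriodic w := by
  rintro ⟨N, T, hT, hp⟩
  refine ha ⟨T, hT, fun n => ?_⟩
  obtain ⟨j, hj, e⟩ := h.exists_ge n (T + 1) N
  have h0 := e 0 (by omega)
  have h1 := e T (by omega)
  rw [← h1, hp j hj]; exact h0

theorem Run.at {x : ℕ → Bool} {b : Bool} {p k q : ℕ} (h : Run x b p k) (h1 : p < q)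
    (h2 : q ≤ p + k) : x q = b := by
  have := h.mid (q - (p + 1)) (by omega)
  rwa [show p + 1 + (q - (p + 1)) = q by omega] at this

theorem Run.at_end {x : ℕ → Bool} {b : Bool} {p k q : ℕ} (h : Run x b p k) (h1 : q = p + k + 1) :
    x q = !b := by
  rw [h1, show p + k + 1 = p + 1 + k by omega]; exact h.right

theorem cnt_one (x : ℕ → Bool) (p : ℕ) : cnt x p 1 = (x p).toNat := by
  simp [cnt]

theorem cnt_two (x : ℕ → Bool) (p : ℕ) : cnt x p 2 = (x p).toNat + (x (p + 1)).toNat := by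
  simp [cnt, Finset.sum_range_succ]

theorem cnt_three (x : ℕ → Bool) (p : ℕ) :
    cnt x p 3 = (x p).toNat + (x (p + 1)).toNat + (x (p + 2)).toNat := by
  simp [cnt, Finset.sum_range_succ]

theorem cnt_const' {x : ℕ → Bool} {b : Bool} {p n : ℕ} (h : ∀ q, p ≤ q → q < p + n → x q = b) :
    cnt x p n = n * b.toNat :=
  cnt_const fun t ht => h _ (by omega) (by omega)

/-- Weight of a letter followed by a constant block. -/
theorem cnt_head {x : ℕ → Bool} {b : Bool} {p n : ℕ} (hn : 0 < n)
    (h : ∀ q, p < q → q < p + n → x q = b) : cnt x p n = (x p).toNat + (n - 1) * b.toNat := by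
  obtain ⟨m, rfl⟩ : ∃ m, n = 1 + m := ⟨n - 1, by omega⟩
  rw [cnt_add, cnt_one, cnt_const' (b := b) (fun q h1 h2 => h q (by omega) (by omega))]
  simp

theorem cls_one_of_run {x : ℕ → Bool} {p k : ℕ} (h : Run x false p k) : Cls x 1 1 (k + 1) 1 := by
  refine ⟨p, ⟨by omega, ?_, ?_, fun e h0 h1 => ?_⟩, ?_⟩
  · rw [cnt_one, h.left]; rfl
  · rw [cnt_one, h.at_end (by omega)]; rfl
  · rw [cnt_one, h.at (by omega) (by omega)]; simp
  · rw [cnt_head (by omega) (fun q h1 h2 => h.at h1 (by omega)), h.left]; simp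

theorem cls_one_of_pair {x : ℕ → Bool} {p l : ℕ} (h : Run x true p l) (hl : 2 ≤ l) :
    Cls x 1 1 1 1 := by
  refine ⟨p + 1, ⟨by omega, ?_, ?_, fun e h0 h1 => by omega⟩, ?_⟩
  · rw [cnt_one, h.at (by omega) (by omega)]; rfl
  · rw [cnt_one, h.at (by omega) (by omega)]; rfl
  · rw [cnt_one, h.at (by omega) (by omega)]; rfl

theorem cls_two_of_run {x : ℕ → Bool} {p k : ℕ} (h : Run x false p k) : Cls x 2 1 k 1 := by
  have hk := h.pos
  refine ⟨p, ⟨by omega, ?_, ?_, fun e h0 h1 => ?_⟩, ?_⟩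
  · rw [cnt_two, h.left, h.at (by omega) (by omega)]; rfl
  · rw [cnt_two, h.at (q := p + k) (by omega) (by omega), h.at_end rfl]; rfl
  · rw [cnt_two, h.at (q := p + e) (by omega) (by omega),
      h.at (q := p + e + 1) (by omega) (by omega)]; simp
  · rw [cnt_head (by omega) (fun q h1 h2 => h.at h1 (by omega)), h.left]; simp

theorem cls_two_of_run' {x : ℕ → Bool} {p k : ℕ} (h : Run x true p k) : Cls x 2 1 k (k - 1) := by
  have hk := h.pos
  refine ⟨p, ⟨by omega, ?_, ?_, fun e h0 h1 => ?_⟩, ?_⟩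
  · rw [cnt_two, h.left, h.at (by omega) (by omega)]; rfl
  · rw [cnt_two, h.at (q := p + k) (by omega) (by omega), h.at_end rfl]; rfl
  · rw [cnt_two, h.at (q := p + e) (by omega) (by omega),
      h.at (q := p + e + 1) (by omega) (by omega)]; simp
  · rw [cnt_head (by omega) (fun q h1 h2 => h.at h1 (by omega)), h.left]; simp

theorem cls_three_of_run {x : ℕ → Bool} {p l : ℕ} (h : Run x true p l) (hl : 2 ≤ l) :
    Cls x 3 2 (l - 1) (l - 2) := by
  refine ⟨p, ⟨by omega, ?_, ?_, fun e h0 h1 => ?_⟩, ?_⟩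
  · rw [cnt_three, h.left, h.at (q := p + 1) (by omega) (by omega),
      h.at (q := p + 2) (by omega) (by omega)]; rfl
  · rw [cnt_three, h.at (q := p + (l - 1)) (by omega) (by omega),
      h.at (q := p + (l - 1) + 1) (by omega) (by omega), h.at_end (by omega)]; rfl
  · rw [cnt_three, h.at (q := p + e) (by omega) (by omega),
      h.at (q := p + e + 1) (by omega) (by omega),
      h.at (q := p + e + 2) (by omega) (by omega)]; simp
  · rw [cnt_head (by omega) (fun q h1 h2 => h.at h1 (by omega)), h.left]; simp; omega

theorem cls_three_of_run' {x : ℕ → Bool} {p k : ℕ} (h : Run x false (p + 1) k) (hk : 2 ≤ k)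
    (h0 : x p = true) (h1 : x (p + k + 3) = true) : Cls x 3 2 (k + 1) 2 := by
  refine ⟨p, ⟨by omega, ?_, ?_, fun e he0 he1 => ?_⟩, ?_⟩
  · rw [cnt_three, h0, h.left, h.at (q := p + 2) (by omega) (by omega)]; rfl
  · rw [cnt_three, h.at (q := p + (k + 1)) (by omega) (by omega), h.at_end (by omega),
      show p + (k + 1) + 2 = p + k + 3 by omega, h1]; rfl
  · rw [cnt_three]
    rcases (show e = 1 ∨ e = k ∨ (1 < e ∧ e < k) by omega) with rfl | rfl | he
    · rw [h.at (q := p + 1 + 1) (by omega) (by omega), h.at (q := p + 1 + 2) (by omega) (by omega)]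
      cases x (p + 1) <;> simp
    · rw [h.at (q := p + e) (by omega) (by omega), h.at (q := p + e + 1) (by omega) (by omega)]
      cases x (p + e + 2) <;> simp
    · rw [h.at (q := p + e) (by omega) (by omega), h.at (q := p + e + 1) (by omega) (by omega)]
      cases x (p + e + 2) <;> simp
  · rw [show k + 1 = 1 + k by omega, cnt_add, cnt_one, h0,
      cnt_head (by omega) (fun q h1 h2 => h.at h1 (by omega)), h.left]; simp

theorem cls_three_of_isolated {x : ℕ → Bool} {p : ℕ} (h : Run x false (p + 1) 1)
    (h0 : x p = true) : Cls x 3 2 1 1 := by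
  refine ⟨p, ⟨by omega, ?_, ?_, fun e he0 he1 => by omega⟩, ?_⟩
  · rw [cnt_three, h0, h.left, h.at (q := p + 2) (by omega) (by omega)]; rfl
  · rw [cnt_three, h.left, h.at (q := p + 1 + 1) (by omega) (by omega), h.at_end (by omega)]; rfl
  · rw [cnt_one, h0]; rfl

/-- Each run length occurs arbitrarily far. -/
def RunRec (x : ℕ → Bool) : Prop :=
  ∀ b p k N, Run x b p k → ∃ q, N ≤ q ∧ Run x b q k

theorem RunRec.compl {x : ℕ → Bool} (h : RunRec x) : RunRec fun i => !x i := by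
  intro b p k N hr
  obtain ⟨q, hq, hr'⟩ := h _ p k N hr.compl
  refine ⟨q, hq, ?_⟩
  have : Run (fun i => !(fun i => !x i) i) (!b) q k := by simpa using hr'
  simpa using this.compl

theorem Recurrent.runRec {w : ℕ → Bool} (h : Recurrent w) : RunRec w := by
  intro b p k N hr
  obtain ⟨q, hq, e⟩ := h.exists_ge p (k + 2) N
  refine ⟨q, hq, hr.pos, ?_, fun t ht => ?_, ?_⟩
  · simpa [hr.left] using e 0 (by omega)
  · rw [add_assoc, e _ (by omega), ← add_assoc]; exact hr.mid t ht
  · rw [add_assoc, e _ (by omega), ← add_assoc]; exact hr.right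

/-- If all runs of `true` have length at least two, with lengths `2` and `l ≥ 3` occurring, and
the runs of `false` have two lengths, one being `2`, then `l = 4`. -/
theorem eq_four_of_runs {x : ℕ → Bool} (hx : ¬ UltimatelyPeriodic x) (h4 : NoFour x)
    (hrec : RunRec x)
    (hge : ∀ p l, Run x true p l → 2 ≤ l) {p₁ p₂ q₁ q₂ l k : ℕ} (h1 : Run x true p₁ 2)
    (h2 : Run x true p₂ l) (hl : 3 ≤ l) (h3 : Run x false q₁ 2) (h5 : Run x false q₂ k)
    (hk : k ≠ 2) : l = 4 := by
  have hpad : ∀ q m, Run x false q m →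
      ∃ r, Run x false (r + 1) m ∧ x r = true ∧ x (r + m + 3) = true := by
    intro q m hq
    obtain ⟨q', hq', hr⟩ := hrec _ _ _ 1 hq
    obtain ⟨r, rfl⟩ : ∃ r, q' = r + 1 := ⟨q' - 1, by omega⟩
    refine ⟨r, hr, ?_, ?_⟩
    · by_contra hc
      have := hge r 1 ⟨le_rfl, by simpa using hc, fun t ht => by
        obtain rfl : t = 0 := by omega
        simpa using hr.left,
        by simpa using hr.at (q := r + 2) (by omega) (by have := hr.pos; omega)⟩
      omega
    · obtain ⟨m', hm'⟩ := hr.next hx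
      have := hge _ _ hm'
      exact hm'.at (by omega) (by omega)
  have c1 := cls_three_of_run h1 le_rfl
  have c2 := cls_three_of_run h2 (by omega)
  obtain ⟨r, hr, hr0, hr1⟩ := hpad _ _ h3
  have c3 := cls_three_of_run' hr le_rfl hr0 hr1
  obtain ⟨s, hs, hs0, hs1⟩ := hpad _ _ h5
  have hkpos := h5.pos
  rcases (show k = 1 ∨ 3 ≤ k by omega) with rfl | hk3
  · have c4 := cls_three_of_isolated hs hs0
    have := h4 _ _ _ _ _ _ _ _ _ _ c1 c2 c3 c4
    omega
  · have c4 := cls_three_of_run' hs (by omega) hs0 hs1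
    have := h4 _ _ _ _ _ _ _ _ _ _ c1 c2 c3 c4
    omega

theorem exists_coding {P : ℕ → Prop} {Q : Bool → ℕ → Prop} {len : Bool → ℕ} {p₀ : ℕ} (h0 : P p₀)
    (step : ∀ p, P p → ∃ b, Q b p ∧ P (p + len b)) :
    ∃ (v : ℕ → Bool) (s : ℕ → ℕ), s 0 = p₀ ∧
      ∀ t, P (s t) ∧ Q (v t) (s t) ∧ s (t + 1) = s t + len (v t) := by
  choose! f hf using step
  set s : ℕ → ℕ := fun t => (fun p => p + len (f p))^[t] p₀ with hs
  have hsucc : ∀ t, s (t + 1) = s t + len (f (s t)) := fun t => by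
    simp only [hs, Function.iterate_succ_apply']
  have hP : ∀ t, P (s t) := by
    intro t
    induction t with
    | zero => exact h0
    | succ t ih => rw [hsucc]; exact (hf _ ih).2
  exact ⟨fun t => f (s t), s, rfl, fun t => ⟨hP t, (hf _ (hP t)).1, hsucc t⟩⟩

/-- A strictly increasing sequence cuts the integers into consecutive blocks. -/
theorem exists_block {s : ℕ → ℕ} (hs : ∀ t, s t < s (t + 1)) {N n : ℕ} (hn : s N ≤ n) :
    ∃ t, N ≤ t ∧ s t ≤ n ∧ n < s (t + 1) := by
  classical
  have hmono : StrictMono s := strictMono_nat_of_lt_succ hs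
  have hex : ∃ t, n < s (t + 1) := ⟨n, lt_of_lt_of_le (Nat.lt_succ_self n) (hmono.le_apply)⟩
  refine ⟨Nat.find hex, ?_, ?_, Nat.find_spec hex⟩
  · by_contra! hc
    have h1 := Nat.find_spec hex
    have h2 : s (Nat.find hex + 1) ≤ s N := hmono.monotone hc
    omega
  · rcases hf : Nat.find hex with _ | m
    · exact le_trans (hmono.monotone (Nat.zero_le N)) hn
    · have := Nat.find_min hex (m := m) (by omega)
      omega

theorem UltimatelyPeriodic.of_coding {x v : ℕ → Bool} {s : ℕ → ℕ} {len : Bool → ℕ}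
    (U : Bool → ℕ → Bool)
    (hlen : ∀ b, 0 < len b) (hs : ∀ t, s (t + 1) = s t + len (v t))
    (hU : ∀ t r, r < len (v t) → x (s t + r) = U (v t) r) (h : UltimatelyPeriodic v) :
    UltimatelyPeriodic x := by
  obtain ⟨N, T, hT, hv⟩ := h
  have hlt : ∀ t, s t < s (t + 1) := fun t => by have := hlen (v t); have := hs t; omega
  have hmono : StrictMono s := strictMono_nat_of_lt_succ hlt
  have hND : s N < s (N + T) := hmono (by omega)
  have hD : ∀ t, s (N + t + T) = s (N + t) + (s (N + T) - s N) := by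
    intro t
    induction t with
    | zero => simp only [add_zero]; omega
    | succ t ih =>
      rw [show N + (t + 1) + T = (N + t + T) + 1 by omega, hs, ih, hv _ (by omega),
        show N + (t + 1) = N + t + 1 by omega, hs]
      omega
  refine ⟨s N, s (N + T) - s N, by omega, fun n hn => ?_⟩
  obtain ⟨t, ht, h1, h2⟩ := exists_block hlt hn
  obtain ⟨t, rfl⟩ := Nat.exists_eq_add_of_le ht
  have hst := hs (N + t)
  have e1 := hU (N + t) (n - s (N + t)) (by omega)
  have e2 := hU (N + t + T) (n - s (N + t)) (by rw [hv _ (by omega)]; omega)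
  rw [hv _ (by omega), ← e1, hD t] at e2
  rw [show n + (s (N + T) - s N) = s (N + t) + (s (N + T) - s N) + (n - s (N + t)) by omega, e2]
  congr 1; omega

theorem Run.of_shift {x : ℕ → Bool} {b : Bool} {p k N : ℕ} (h : Run (fun i => x (i + N)) b p k) :
    Run x b (p + N) k :=
  ⟨h.pos, h.left, fun t ht => by
      rw [show p + N + 1 + t = p + 1 + t + N by omega]; exact h.mid t ht, by
    rw [show p + N + 1 + k = p + 1 + k + N by omega]; exact h.right⟩

theorem exists_two_runs_ge {x : ℕ → Bool} (h : ¬ UltimatelyPeriodic x) (N : ℕ) :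
    ∃ b p k q l, k < l ∧ N ≤ p ∧ N ≤ q ∧ Run x b p k ∧ Run x b q l := by
  have h' : ¬ UltimatelyPeriodic fun i => x (i + N) := by
    rintro ⟨M, T, hT, hp⟩
    refine h ⟨M + N, T, hT, fun n hn => ?_⟩
    have := hp (n - N) (by omega)
    simp only at this
    rwa [show n - N + T + N = n + T by omega, show n - N + N = n by omega] at this
  obtain ⟨b, p, k, q, l, hkl, h1, h2⟩ := exists_two_runs h'
  exact ⟨b, p + N, k, q + N, l, hkl, by omega, by omega, h1.of_shift, h2.of_shift⟩

/-- Before a run of `b` that is not the first occurrence of `b` there is a run of the other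
letter. -/
theorem Run.prev {x : ℕ → Bool} {b : Bool} {p k q : ℕ} (h : Run x b p k) (hq : q ≤ p)
    (hb : x q = b) : ∃ r l, r + l = p ∧ Run x (!b) r l := by
  have hr : x (Nat.findGreatest (fun r => x r = b) p) = b :=
    Nat.findGreatest_spec (P := fun r => x r = b) hq hb
  set r := Nat.findGreatest (fun r => x r = b) p with hrdef
  have hle : r ≤ p := Nat.findGreatest_le p
  have hne : r ≠ p := fun e => by
    have := h.left
    rw [← e, hr] at this
    cases b <;> simp at this
  refine ⟨r, p - r, by omega, by omega, by simpa using hr, fun t ht => ?_, ?_⟩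
  · have : ¬ x (r + 1 + t) = b :=
      Nat.findGreatest_is_greatest (P := fun r => x r = b) (n := p) (by omega) (by omega)
    revert this
    cases x (r + 1 + t) <;> cases b <;> simp
  · rw [show r + 1 + (p - r) = p + 1 by omega, Bool.not_not]
    exact h.at (by omega) (by have := h.pos; omega)

theorem Cls.of_prefix {x : ℕ → Bool} {n c i j : ℕ} (hd : i < j)
    (h1 : cnt x 0 (i + n) = cnt x 0 i + c) (h2 : cnt x 0 (j + n) = cnt x 0 j + c)
    (h3 : ∀ p, i < p → p < j → cnt x 0 (p + n) ≠ cnt x 0 p + c) :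
    Cls x n c (j - i) (cnt x 0 j - cnt x 0 i) := by
  have key : ∀ p m, cnt x 0 (p + m) = cnt x 0 p + cnt x p m := fun p m => by
    rw [cnt_add, zero_add]
  refine ⟨i, ⟨by omega, ?_, ?_, fun e he0 he1 => ?_⟩, ?_⟩
  · have := key i n; omega
  · rw [show i + (j - i) = j by omega]; have := key j n; omega
  · have := key (i + e) n; have := h3 (i + e) (by omega) (by omega); omega
  · have := key i (j - i); rw [show i + (j - i) = j by omega] at this; omega

theorem cnt_mono {x : ℕ → Bool} {p q : ℕ} (h : p ≤ q) :
    cnt x 0 p ≤ cnt x 0 q ∧ cnt x 0 q ≤ cnt x 0 p + (q - p) := by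
  obtain ⟨d, rfl⟩ := Nat.exists_eq_add_of_le h
  rw [cnt_add]
  have := cnt_le x (0 + p) d
  omega

/-- The word `x` is, from position `e 0` on, the concatenation of the words `1 ^ l₁ 0 ^ k` and
`1 ^ l₂ 0 ^ k` in the order given by `v`; the length of the run of ones at `e t` is `L t`. -/
structure Coded (x v : ℕ → Bool) (e L : ℕ → ℕ) (k l₁ l₂ : ℕ) : Prop where
  ff : ∀ t, v t = false → L t = l₁
  tt : ∀ t, v t = true → L t = l₂
  step : ∀ t, e (t + 1) = e t + L t + k
  val : ∀ t p, e t ≤ p → p ≤ e t + L t + k → cnt x 0 p = cnt x 0 (e t) + min (p - e t) (L t)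

namespace Coded

variable {x v : ℕ → Bool} {e L : ℕ → ℕ} {k l₁ l₂ : ℕ}

theorem next (h : Coded x v e L k l₁ l₂) (t t' : ℕ) (ht : t' = t + 1) :
    e t' = e t + L t + k ∧ cnt x 0 (e t') = cnt x 0 (e t) + L t := by
  subst ht
  have h1 := h.step t
  refine ⟨h1, ?_⟩
  rw [h.val t (e (t + 1)) (by omega) (by omega)]
  omega

theorem le_len (h : Coded x v e L k l₁ l₂) (hl : l₁ ≤ l₂) (t : ℕ) : l₁ ≤ L t ∧ L t ≤ l₂ := by
  rcases hv : v t with _ | _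
  · rw [h.ff t hv]; omega
  · rw [h.tt t hv]; omega

/-- Block of letters `false` in the coding. -/
theorem const_false (h : Coded x v e L k l₁ l₂) {t m : ℕ}
    (hv : ∀ u, t ≤ u → u < t + m → v u = false) :
    e (t + m) = e t + m * l₁ + m * k ∧ cnt x 0 (e (t + m)) = cnt x 0 (e t) + m * l₁ := by
  induction m with
  | zero => simp
  | succ m ih =>
    have ⟨i1, i2⟩ := ih fun u h1 h2 => hv u h1 (by omega)
    have ⟨h1, h2⟩ := h.next (t + m) (t + (m + 1)) rfl
    rw [h.ff (t + m) (hv _ (by omega) (by omega))] at h1 h2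
    rw [h2, h1, i2, i1, add_mul, add_mul]
    omega

/-- Block of letters `true` in the coding. -/
theorem const_true (h : Coded x v e L k l₁ l₂) {t m : ℕ}
    (hv : ∀ u, t ≤ u → u < t + m → v u = true) :
    e (t + m) = e t + m * (l₂ + k) := by
  induction m with
  | zero => simp
  | succ m ih =>
    have i1 := ih fun u h1 h2 => hv u h1 (by omega)
    have ⟨h1, h2⟩ := h.next (t + m) (t + (m + 1)) rfl
    rw [h.tt (t + m) (hv _ (by omega) (by omega))] at h1
    rw [h1, i1, add_mul]
    omega

theorem zeros (h : Coded x v e L k l₁ l₂) (t m : ℕ) :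
    e (t + m) + cnt x 0 (e t) = e t + cnt x 0 (e (t + m)) + m * k := by
  induction m with
  | zero => simp
  | succ m ih =>
    have ⟨h1, h2⟩ := h.next (t + m) (t + (m + 1)) rfl
    rw [h2, h1, add_mul, one_mul]
    omega

theorem le_val (h : Coded x v e L k l₁ l₂) (hl : l₁ ≤ l₂) (t m : ℕ) :
    cnt x 0 (e t) + m * l₁ ≤ cnt x 0 (e (t + m)) := by
  induction m with
  | zero => simp
  | succ m ih =>
    have ⟨h1, h2⟩ := h.next (t + m) (t + (m + 1)) rfl
    have := (h.le_len hl (t + m)).1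
    rw [h2, add_mul, one_mul]
    omega

theorem strictMono (h : Coded x v e L k l₁ l₂) (hk : 0 < k) : StrictMono e :=
  strictMono_nat_of_lt_succ fun t => by have := h.step t; omega

theorem cls_zero_of_false_true (h : Coded x v e L k l₁ l₂) (hk : 2 ≤ k) (hl : l₁ < l₂) {u : ℕ}
    (v1 : v (u + 1) = false) (v2 : v (u + 2) = true) :
    Cls x (k + 1 + l₁ + l₂) (l₁ + l₂) 1 0 := by
  obtain ⟨s0, o0⟩ := h.next u (u + 1) rfl
  obtain ⟨s1, o1⟩ := h.next (u + 1) (u + 2) rfl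
  have L1 := h.ff _ v1
  have L2 := h.tt _ v2
  have a1 := h.val u (e (u + 1) - 1) (by omega) (by omega)
  have a2 := h.val (u + 2) (e (u + 1) - 1 + (k + 1 + l₁ + l₂)) (by omega) (by omega)
  have a3 := h.val (u + 2) (e (u + 1) + (k + 1 + l₁ + l₂)) (by omega) (by omega)
  have := Cls.of_prefix (x := x) (n := k + 1 + l₁ + l₂) (c := l₁ + l₂) (i := e (u + 1) - 1)
    (j := e (u + 1)) (by omega) (by omega) (by omega) (fun p _ _ => by omega)
  convert this using 1 <;> omega

theorem cls_of_false_true (h : Coded x v e L k l₁ l₂) (hk : 2 ≤ k) (h1 : 1 ≤ l₁)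
    (hl : l₁ < l₂) {u : ℕ} (v1 : v u = false) (v2 : v (u + 1) = true) :
    ∃ o, Cls x (k + 1 + l₁ + l₂) (l₁ + l₂) (l₁ + k - 1) o := by
  obtain ⟨s0, o0⟩ := h.next u (u + 1) rfl
  obtain ⟨s1, o1⟩ := h.next (u + 1) (u + 2) rfl
  obtain ⟨s2, o2⟩ := h.next (u + 2) (u + 3) rfl
  have L0 := h.ff _ v1
  have L1 := h.tt _ v2
  have L2 := h.le_len hl.le (u + 2)
  have a1 := h.val u (e (u + 1) - 1) (by omega) (by omega)
  have a2 := h.val (u + 1) (e u + (k + 1 + l₁ + l₂)) (by omega) (by omega)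
  have a3 := h.val (u + 2) (e (u + 1) - 1 + (k + 1 + l₁ + l₂)) (by omega) (by omega)
  have := Cls.of_prefix (x := x) (n := k + 1 + l₁ + l₂) (c := l₁ + l₂) (i := e u)
    (j := e (u + 1) - 1) (by omega) (by omega) (by omega) (fun p p1 p2 => by
      have b1 := h.val u p (by omega) (by omega)
      rcases le_total (p + (k + 1 + l₁ + l₂)) (e (u + 2)) with hc | hc
      · have b2 := h.val (u + 1) (p + (k + 1 + l₁ + l₂)) (by omega) (by omega)
        omega
      · have b2 := h.val (u + 2) (p + (k + 1 + l₁ + l₂)) (by omega) (by omega)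
        omega)
  exact ⟨_, by convert this using 1; omega⟩

theorem ne_of_mem_run (h : Coded x v e L k l₁ l₂) (hk : 2 ≤ k) {u p : ℕ}
    (w1 : v (u + 1) = false) (hL : L u - (p - e u) < l₂) (u1 : e u ≤ p) (hp : p ≤ e u + L u) :
    cnt x 0 (p + (k + 1 + l₁ + l₂)) ≠ cnt x 0 p + (l₁ + l₂) := by
  obtain ⟨r0, q0⟩ := h.next u (u + 1) rfl
  obtain ⟨r1, q1⟩ := h.next (u + 1) (u + 2) rfl
  have w1 := h.ff (u + 1) w1
  have b1 := h.val u p (by omega) (by omega)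
  rcases le_total (p + (k + 1 + l₁ + l₂)) (e (u + 2)) with hc | hc
  · have := (cnt_mono (x := x) hc).1
    omega
  · have := (cnt_mono (x := x) hc).2
    omega

theorem ne_of_mem_gap (h : Coded x v e L k l₁ l₂) (hk : 2 ≤ k) (hl : l₁ < l₂)
    {u p : ℕ} (w1 : v (u + 1) = false) (w2 : v (u + 2) = false)
    (hp : e u + L u ≤ p) (u2 : p < e (u + 1)) :
    cnt x 0 (p + (k + 1 + l₁ + l₂)) ≠ cnt x 0 p + (l₁ + l₂) := by
  obtain ⟨r0, q0⟩ := h.next u (u + 1) rfl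
  obtain ⟨r1, q1⟩ := h.next (u + 1) (u + 2) rfl
  obtain ⟨r2, q2⟩ := h.next (u + 2) (u + 3) rfl
  have w1 := h.ff (u + 1) w1
  have w2 := h.ff (u + 2) w2
  have b1 := h.val u p (by omega) (by omega)
  rcases le_total (p + (k + 1 + l₁ + l₂)) (e (u + 3)) with hc | hc
  · have := (cnt_mono (x := x) hc).1
    omega
  · have := (cnt_mono (x := x) hc).2
    omega

theorem ne_of_mem_last_gap (h : Coded x v e L k l₁ l₂) (h1 : 1 ≤ l₁) (hl : l₁ < l₂)
    {u p : ℕ} (w1 : v (u + 1) = false) (hp : e u + L u ≤ p) (u2 : p + 1 < e (u + 1)) :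
    cnt x 0 (p + (k + 1 + l₁ + l₂)) ≠ cnt x 0 p + (l₁ + l₂) := by
  obtain ⟨r0, q0⟩ := h.next u (u + 1) rfl
  obtain ⟨r1, q1⟩ := h.next (u + 1) (u + 2) rfl
  have w1 := h.ff (u + 1) w1
  have b1 := h.val u p (by omega) (by omega)
  rcases le_total (p + (k + 1 + l₁ + l₂)) (e (u + 2)) with hc | hc
  · have := (cnt_mono (x := x) hc).1
    omega
  · have := (cnt_mono (x := x) hc).2
    omega

theorem cls_of_run_false (h : Coded x v e L k l₁ l₂) (hk : 2 ≤ k) (h1 : 1 ≤ l₁)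
    (hl : l₁ < l₂) {t m : ℕ} (hr : Run v false t (m + 1)) :
    ∃ o, Cls x (k + 1 + l₁ + l₂) (l₁ + l₂) (l₂ + k + m * (l₁ + k) - 1) o := by
  have hmono := h.strictMono (by omega)
  obtain ⟨s0, o0⟩ := h.next t (t + 1) rfl
  obtain ⟨s1, o1⟩ := h.next (t + 1) (t + 2) rfl
  obtain ⟨sm, om⟩ := h.next (t + m) (t + m + 1) rfl
  obtain ⟨s2, o2⟩ := h.next (t + m + 1) (t + m + 2) rfl
  have L0 := h.tt t hr.left
  have L1 := h.ff (t + 1) (hr.at (by omega) (by omega))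
  have L2 := h.ff (t + m + 1) (hr.at (by omega) (by omega))
  have L3 := h.tt (t + m + 2) (hr.at_end (by omega))
  have hem := (h.const_false (t := t + 1) (m := m)
    (fun u h1 h2 => hr.at (by omega) (by omega))).1
  rw [show t + 1 + m = t + m + 1 by omega] at hem
  have htm : e (t + 1) ≤ e (t + m + 1) := hmono.monotone (by omega)
  have a1 := h.val (t + m) (e (t + m + 1) - 1) (by omega) (by omega)
  have a2 := h.val (t + 1) (e t + (k + 1 + l₁ + l₂)) (by omega) (by omega)
  have a3 := h.val (t + m + 2) (e (t + m + 1) - 1 + (k + 1 + l₁ + l₂)) (by omega) (by omega)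
  have := Cls.of_prefix (x := x) (n := k + 1 + l₁ + l₂) (c := l₁ + l₂) (i := e t)
    (j := e (t + m + 1) - 1) (by omega) (by omega) (by omega) (fun p p1 p2 => by
      obtain ⟨u, hu, u1, u2⟩ := exists_block (fun t => hmono (Nat.lt_succ_self t))
        (show e t ≤ p by omega)
      have hum : u ≤ t + m := by
        by_contra! hc
        have : e (t + m + 1) ≤ e u := hmono.monotone (by omega)
        omega
      have w1 := hr.at (q := u + 1) (by omega) (by omega)
      have hL : L u - (p - e u) < l₂ := by
        rcases eq_or_lt_of_le hu with rfl | h5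
        · omega
        · have := h.ff u (hr.at (by omega) (by omega))
          omega
      rcases le_total p (e u + L u) with hp | hp
      · exact h.ne_of_mem_run hk w1 hL u1 hp
      · rcases eq_or_lt_of_le hum with rfl | hum
        · exact h.ne_of_mem_last_gap h1 hl w1 hp (by omega)
        · exact h.ne_of_mem_gap hk hl w1 (hr.at (by omega) (by omega)) hp u2)
  have hd : e (t + m + 1) - 1 - e t = l₂ + k + m * (l₁ + k) - 1 := by
    rw [mul_add]; omega
  rw [hd] at this
  exact ⟨_, this⟩

/-- The blocks with a short run of ones cannot come in groups of two different sizes. -/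
theorem false_runs_eq (h : Coded x v e L k l₁ l₂) (h4 : NoFour x) (hk : 2 ≤ k) (h1 : 1 ≤ l₁)
    (hl : l₁ < l₂) {t m t' m' : ℕ} (hr : Run v false t m) (hr' : Run v false t' m') :
    ¬ m < m' := by
  intro hmm
  obtain ⟨a, rfl⟩ : ∃ a, m = a + 1 := ⟨m - 1, by have := hr.pos; omega⟩
  obtain ⟨b, rfl⟩ : ∃ b, m' = b + 1 := ⟨m' - 1, by omega⟩
  have c1 := h.cls_zero_of_false_true hk hl (u := t + a) (hr.at (by omega) (by omega))
    (hr.at_end (by omega))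
  obtain ⟨o2, c2⟩ := h.cls_of_false_true hk h1 hl (u := t + a + 1) (hr.at (by omega) (by omega))
    (hr.at_end (by omega))
  obtain ⟨o3, c3⟩ := h.cls_of_run_false hk h1 hl hr
  obtain ⟨o4, c4⟩ := h.cls_of_run_false hk h1 hl hr'
  have := h4 _ _ _ _ _ _ _ _ _ _ c1 c2 c3 c4
  have hprod : a * (l₁ + k) < b * (l₁ + k) := Nat.mul_lt_mul_of_pos_right (by omega) (by omega)
  omega

theorem cls_zero_of_run (h : Coded x v e L k l₁ l₂) (hk : 2 ≤ k) {t m : ℕ}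
    (hr : Run v false t m) :
    Cls x (m * l₁ + m * k + (k + 1 + l₂)) (m * l₁ + l₂) 1 0 := by
  obtain ⟨s0, o0⟩ := h.next t (t + 1) rfl
  obtain ⟨s1, o1⟩ := h.next (t + 1 + m) (t + 1 + m + 1) rfl
  obtain ⟨em, om⟩ := h.const_false (t := t + 1) (m := m)
    (fun u h1 h2 => hr.at (by omega) (by omega))
  have L1 := h.tt (t + 1 + m) (hr.at_end (by omega))
  have a1 := h.val t (e (t + 1) - 1) (by omega) (by omega)
  have a2 := h.val t (e (t + 1) - 2) (by omega) (by omega)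
  have b1 := h.val (t + 1 + m) (e (t + 1) - 1 + (m * l₁ + m * k + (k + 1 + l₂)))
    (by omega) (by omega)
  have b2 := h.val (t + 1 + m) (e (t + 1) - 2 + (m * l₁ + m * k + (k + 1 + l₂)))
    (by omega) (by omega)
  have := Cls.of_prefix (x := x) (n := m * l₁ + m * k + (k + 1 + l₂)) (c := m * l₁ + l₂)
    (i := e (t + 1) - 2) (j := e (t + 1) - 1) (by omega) (by omega) (by omega)
    (fun p _ _ => by omega)
  convert this using 1 <;> omega

theorem cls_of_true_run (h : Coded x v e L k l₁ l₂) (hk : 2 ≤ k) {t m : ℕ}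
    (hr : Run v false (t + 1) m) :
    ∃ o, Cls x (m * l₁ + m * k + (k + 1 + l₂)) (m * l₁ + l₂) (l₂ + 1) o := by
  obtain ⟨s0, o0⟩ := h.next t (t + 1) rfl
  obtain ⟨s1, o1⟩ := h.next (t + 1) (t + 2) rfl
  obtain ⟨s2, o2⟩ := h.next (t + 2 + m) (t + 2 + m + 1) rfl
  obtain ⟨em, om⟩ := h.const_false (t := t + 2) (m := m)
    (fun u h1 h2 => hr.at (by omega) (by omega))
  have L1 := h.tt (t + 1) hr.left
  have L2 := h.tt (t + 2 + m) (hr.at_end (by omega))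
  have a1 := h.val t (e (t + 1) - 1) (by omega) (by omega)
  have a2 := h.val (t + 1) (e (t + 1) + l₂) (by omega) (by omega)
  have b1 := h.val (t + 2 + m) (e (t + 1) - 1 + (m * l₁ + m * k + (k + 1 + l₂)))
    (by omega) (by omega)
  have b2 := h.val (t + 2 + m) (e (t + 1) + l₂ + (m * l₁ + m * k + (k + 1 + l₂)))
    (by omega) (by omega)
  have := Cls.of_prefix (x := x) (n := m * l₁ + m * k + (k + 1 + l₂)) (c := m * l₁ + l₂)
    (i := e (t + 1) - 1) (j := e (t + 1) + l₂) (by omega) (by omega) (by omega)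
    (fun p _ _ => by
      have a3 := h.val (t + 1) p (by omega) (by omega)
      have b3 := h.val (t + 2 + m) (p + (m * l₁ + m * k + (k + 1 + l₂))) (by omega) (by omega)
      omega)
  exact ⟨_, by convert this using 1; omega⟩

theorem cls_of_run_true_one (h : Coded x v e L k l₁ l₂) (hk : 2 ≤ k) {t m : ℕ}
    (hr : Run v false t m) (hf : v (t + m + 2) = false) :
    ∃ o, Cls x (m * l₁ + m * k + (k + 1 + l₂)) (m * l₁ + l₂) (l₁ + 1) o := by
  have hm := hr.pos
  obtain ⟨s0, o0⟩ := h.next t (t + 1) rfl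
  obtain ⟨s1, o1⟩ := h.next (t + 1) (t + 2) rfl
  obtain ⟨s2, o2⟩ := h.next (t + 1 + m) (t + m + 2) (by omega)
  obtain ⟨em, om⟩ := h.const_false (t := t + 1) (m := m)
    (fun u h1 h2 => hr.at (by omega) (by omega))
  have L1 := h.ff (t + 1) (hr.at (by omega) (by omega))
  have L2 := h.tt (t + 1 + m) (hr.at_end (by omega))
  have L3 := h.ff _ hf
  have a1 := h.val t (e (t + 1) - 1) (by omega) (by omega)
  have a2 := h.val (t + 1) (e (t + 1) + l₁) (by omega) (by omega)
  have b1 := h.val (t + 1 + m) (e (t + 1) - 1 + (m * l₁ + m * k + (k + 1 + l₂)))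
    (by omega) (by omega)
  have b2 := h.val (t + m + 2) (e (t + 1) + l₁ + (m * l₁ + m * k + (k + 1 + l₂)))
    (by omega) (by omega)
  have := Cls.of_prefix (x := x) (n := m * l₁ + m * k + (k + 1 + l₂)) (c := m * l₁ + l₂)
    (i := e (t + 1) - 1) (j := e (t + 1) + l₁) (by omega) (by omega) (by omega)
    (fun p _ _ => by
      have a3 := h.val (t + 1) p (by omega) (by omega)
      have b3 := h.val (t + m + 2) (p + (m * l₁ + m * k + (k + 1 + l₂))) (by omega) (by omega)
      omega)
  exact ⟨_, by convert this using 1; omega⟩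

/-- Two consecutive long runs of ones among `m + 1` consecutive runs. -/
theorem two_long_le (h : Coded x v e L k l₁ l₂) (hl : l₁ ≤ l₂) {f u m : ℕ} (h1 : f ≤ u)
    (h2 : u + 1 ≤ f + m) (v1 : v u = true) (v2 : v (u + 1) = true) :
    cnt x 0 (e f) + m * l₁ + 2 * l₂ ≤ cnt x 0 (e (f + m + 1)) + l₁ := by
  obtain ⟨a, rfl⟩ := Nat.exists_eq_add_of_le h1
  obtain ⟨b, rfl⟩ : ∃ b, m = a + b + 1 := ⟨m - a - 1, by omega⟩
  have c1 := h.le_val hl f a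
  have c2 := h.le_val hl (f + a + 2) b
  have o1 := (h.next (f + a) (f + a + 1) rfl).2
  have o2 := (h.next (f + a + 1) (f + a + 2) rfl).2
  rw [h.tt _ v1] at o1
  rw [h.tt _ v2] at o2
  rw [show f + a + 2 + b = f + (a + b + 1) + 1 by omega] at c2
  rw [add_mul, add_mul]
  omega

/-- A window of length `n` starting between the runs of ones with indices `f` and `f + 1` has
too few zeros if it ends before run number `f + 1 + m` does. -/
theorem lt_of_end_le (h : Coded x v e L k l₁ l₂) {f m p : ℕ} (hp : e f ≤ p)
    (hpe : p ≤ e (f + 1))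
    (hc : p + (m * l₁ + m * k + (k + 1 + l₂)) ≤ e (f + 1 + m) + L (f + 1 + m)) :
    cnt x 0 p + (m * l₁ + l₂) < cnt x 0 (p + (m * l₁ + m * k + (k + 1 + l₂))) := by
  obtain ⟨s0, o0⟩ := h.next f (f + 1) rfl
  have hz := h.zeros (f + 1) m
  have a1 := h.val f p hp (by omega)
  have a2 := h.val (f + 1 + m) (e (f + 1 + m) + L (f + 1 + m)) (by omega) (by omega)
  have := (cnt_mono (x := x) hc).2
  omega

theorem le_of_end_ge (h : Coded x v e L k l₁ l₂) {f n p : ℕ} (hc : e f + L f ≤ p + n) :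
    cnt x 0 (e f) + L f ≤ cnt x 0 (p + n) := by
  have m1 := (cnt_mono (x := x) hc).1
  have := h.val f (e f + L f) (by omega) (by omega)
  omega

theorem lt_of_mem_run_true (h : Coded x v e L k l₁ l₂) (hl : l₁ < l₂) {t m a f p : ℕ}
    (hr' : Run v true (t + m) (a + 2)) (hr'' : Run v false (t + m + (a + 2)) m)
    (ht : t + 1 ≤ f) (hfa : f ≤ t + 1 + m + a) (f1 : e f ≤ p) (f2 : p ≤ e (f + 1))
    (hp : f = t + 1 + m + a → p < e f + l₂) :
    cnt x 0 p + (m * l₁ + l₂) < cnt x 0 (p + (m * l₁ + m * k + (k + 1 + l₂))) := by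
  rcases le_total (p + (m * l₁ + m * k + (k + 1 + l₂))) (e (f + 1 + m) + L (f + 1 + m))
    with hc | hc
  · exact h.lt_of_end_le f1 f2 hc
  have hm := hr''.pos
  have m1 := h.le_of_end_ge hc
  have o6 := (h.next (f + 1 + m) (f + 1 + m + 1) rfl).2
  rcases eq_or_lt_of_le hfa with rfl | hfa
  · obtain ⟨s3, o3⟩ := h.next (t + 1 + m + a) (t + m + (a + 2)) (by omega)
    obtain ⟨s4, o4⟩ := h.next (t + m + (a + 2)) (t + m + (a + 2) + 1) rfl
    have om := (h.const_false (t := t + m + (a + 2) + 1) (m := m)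
      (fun u h1 h2 => hr''.at (by omega) (by omega))).2
    rw [show t + m + (a + 2) + 1 + m = t + 1 + m + a + 1 + m + 1 by omega] at om
    have L3 := h.tt (t + 1 + m + a) (hr'.at (by omega) (by omega))
    have L4 := h.tt (t + m + (a + 2)) (hr'.at (by omega) (by omega))
    have := h.val (t + 1 + m + a) p (by omega) (by omega)
    omega
  · obtain ⟨u, u1, u2, v1, v2⟩ : ∃ u, f + 1 ≤ u ∧ u + 1 ≤ f + 1 + m ∧ v u = true ∧
        v (u + 1) = true := by
      rcases le_total f (t + m) with hc | hc
      · exact ⟨t + m + 1, by omega, by omega, hr'.at (by omega) (by omega),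
          hr'.at (by omega) (by omega)⟩
      · exact ⟨f + 1, by omega, by omega, hr'.at (by omega) (by omega),
          hr'.at (by omega) (by omega)⟩
    have m2 := h.two_long_le hl.le u1 u2 v1 v2
    have m3 := (cnt_mono (x := x) f2).1
    omega

theorem start_of_run_true (h : Coded x v e L k l₁ l₂) (hk : 2 ≤ k) {t m : ℕ}
    (hr : Run v false t m) (ht : v (t + m + 1) = true) :
    cnt x 0 (e (t + 1) - 1 + (m * l₁ + m * k + (k + 1 + l₂)))
      = cnt x 0 (e (t + 1) - 1) + (m * l₁ + l₂) := by
  obtain ⟨s0, o0⟩ := h.next t (t + 1) rfl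
  obtain ⟨em, om⟩ := h.const_false (t := t + 1) (m := m)
    (fun u h1 h2 => hr.at (by omega) (by omega))
  rw [show t + 1 + m = t + m + 1 by omega] at em om
  have L2 := h.tt _ ht
  have a1 := h.val t (e (t + 1) - 1) (by omega) (by omega)
  have b1 := h.val (t + m + 1) (e (t + 1) - 1 + (m * l₁ + m * k + (k + 1 + l₂)))
    (by omega) (by omega)
  omega

theorem ne_of_run_true (h : Coded x v e L k l₁ l₂) (hl : l₁ < l₂) {t m : ℕ}
    (hr : Run v false t m) (ht : v (t + m + 1) = true) (ht' : v (t + m + 2) = true) :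
    cnt x 0 (e (t + 1) + (m * l₁ + m * k + (k + 1 + l₂)))
      ≠ cnt x 0 (e (t + 1)) + (m * l₁ + l₂) := by
  obtain ⟨em, om⟩ := h.const_false (t := t + 1) (m := m)
    (fun u h1 h2 => hr.at (by omega) (by omega))
  rw [show t + 1 + m = t + m + 1 by omega] at em om
  obtain ⟨s2, o2⟩ := h.next (t + m + 1) (t + m + 2) rfl
  have L2 := h.tt _ ht
  have L2' := h.tt _ ht'
  have := h.val (t + m + 2) (e (t + 1) + (m * l₁ + m * k + (k + 1 + l₂))) (by omega) (by omega)
  omega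

theorem finish_of_run_true (h : Coded x v e L k l₁ l₂) (hk : 2 ≤ k) {t m : ℕ}
    (v0 : v t = true) (hr : Run v false (t + 1) m) :
    cnt x 0 (e t + l₂ + (m * l₁ + m * k + (k + 1 + l₂)))
      = cnt x 0 (e t + l₂) + (m * l₁ + l₂) := by
  have hm := hr.pos
  obtain ⟨s3, o3⟩ := h.next t (t + 1) rfl
  obtain ⟨s4, o4⟩ := h.next (t + 1) (t + 2) rfl
  obtain ⟨em, om⟩ := h.const_false (t := t + 2) (m := m)
    (fun u h1 h2 => hr.at (by omega) (by omega))
  obtain ⟨s5, o5⟩ := h.next (t + 1 + m) (t + 2 + m) (by omega)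
  have L3 := h.tt t v0
  have L4 := h.tt (t + 1) hr.left
  have L5 := h.ff (t + 1 + m) (hr.at (by omega) (by omega))
  have a2 := h.val t (e t + l₂) (by omega) (by omega)
  have b2 := h.val (t + 1 + m) (e t + l₂ + (m * l₁ + m * k + (k + 1 + l₂)))
    (by omega) (by omega)
  omega

theorem cls_of_run_true (h : Coded x v e L k l₁ l₂) (hk : 2 ≤ k) (hl : l₁ < l₂) {t m a : ℕ}
    (hr : Run v false t m) (hr' : Run v true (t + m) (a + 2))
    (hr'' : Run v false (t + m + (a + 2)) m) :
    ∃ o, Cls x (m * l₁ + m * k + (k + 1 + l₂)) (m * l₁ + l₂)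
      (m * l₁ + m * k + a * (l₂ + k) + l₂ + 1) o := by
  have hmono := h.strictMono (by omega)
  have h1 := h.start_of_run_true hk hr (hr'.at (by omega) (by omega))
  have h2 := h.ne_of_run_true hl hr (hr'.at (by omega) (by omega)) (hr'.at (by omega) (by omega))
  have h3 := h.finish_of_run_true hk (t := t + 1 + m + a) (m := m)
    (hr'.at (by omega) (by omega))
    (by rw [show t + 1 + m + a + 1 = t + m + (a + 2) by omega]; exact hr'')
  have em := (h.const_false (t := t + 1) (m := m)
    (fun u h1 h2 => hr.at (by omega) (by omega))).1
  have et := h.const_true (t := t + 1 + m) (m := a)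
    (fun u h1 h2 => hr'.at (by omega) (by omega))
  have h0 : 0 < e (t + 1) := lt_of_le_of_lt (Nat.zero_le _) (hmono (Nat.lt_succ_self t))
  have hd : e (t + 1 + m + a) + l₂ - (e (t + 1) - 1)
      = m * l₁ + m * k + a * (l₂ + k) + l₂ + 1 := by omega
  rw [← hd]
  refine ⟨_, Cls.of_prefix (by omega) h1 h3 fun p p1 p2 => ?_⟩
  rcases eq_or_lt_of_le (show e (t + 1) ≤ p by omega) with rfl | p3
  · exact h2
  obtain ⟨f, hf, f1, f2⟩ := exists_block (fun t => hmono (Nat.lt_succ_self t)) p3.le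
  have hfa : f ≤ t + 1 + m + a := by
    by_contra! hc
    have h4 : e (t + 1 + m + a + 1) ≤ e f := hmono.monotone (by omega)
    have h5 := h.step (t + 1 + m + a)
    rw [h.tt (t + 1 + m + a) (hr'.at (by omega) (by omega))] at h5
    omega
  exact Nat.ne_of_gt (h.lt_of_mem_run_true hl hr' hr'' hf hfa f1 f2.le
    (fun hf => by rw [hf]; exact p2))

theorem run_false_eq (h : Coded x v e L k l₁ l₂) (h4 : NoFour x) (hk : 2 ≤ k) (h1 : 1 ≤ l₁)
    (hl : l₁ < l₂) {t m t' m' : ℕ} (hr : Run v false t m) (hr' : Run v false t' m') : m' = m := by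
  have := h.false_runs_eq h4 hk h1 hl hr hr'
  have := h.false_runs_eq h4 hk h1 hl hr' hr
  omega

theorem cls_of_any_run_true (h : Coded x v e L k l₁ l₂) (h4 : NoFour x)
    (hx : ¬ UltimatelyPeriodic v)
    (hk : 2 ≤ k) (h1 : 1 ≤ l₁) (hl : l₁ < l₂) {s m t j : ℕ} (hm : Run v false s m) (hs : s ≤ t)
    (hr : Run v true t j) :
    ∃ o, Cls x (m * l₁ + m * k + (k + 1 + l₂)) (m * l₁ + l₂)
      (if j = 1 then l₁ + 1 else m * l₁ + m * k + (j - 2) * (l₂ + k) + l₂ + 1) o := by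
  obtain ⟨t0, m0, rfl, h0⟩ := hr.prev hs hm.left
  obtain rfl := h.run_false_eq h4 hk h1 hl hm h0
  obtain ⟨m1, h2⟩ := hr.next hx
  obtain rfl := h.run_false_eq h4 hk h1 hl hm h2
  split_ifs with hj
  · subst hj
    exact h.cls_of_run_true_one hk h0 (hr.at_end (by omega))
  · obtain ⟨a, rfl⟩ : ∃ a, j = a + 2 := ⟨j - 2, by have := hr.pos; omega⟩
    exact h.cls_of_run_true hk hl h0 hr h2

theorem not_noFour (h : Coded x v e L k l₁ l₂) (hx : ¬ UltimatelyPeriodic v) (hk : 2 ≤ k)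
    (h1 : 1 ≤ l₁)
    (hl : l₁ < l₂) : ¬ NoFour x := by
  intro h4
  obtain ⟨s, m, hs, hm⟩ := exists_run_ge hx false 1
  obtain ⟨s, rfl⟩ : ∃ r, s = r + 1 := ⟨s - 1, by omega⟩
  obtain ⟨b, p, j, q, j', hj, hp, hq, r1, r2⟩ := exists_two_runs_ge hx (s + 1)
  cases b
  · exact h.false_runs_eq h4 hk h1 hl r1 r2 hj
  have c1 := h.cls_zero_of_run hk hm
  obtain ⟨o2, c2⟩ := h.cls_of_true_run hk hm
  obtain ⟨o3, c3⟩ := h.cls_of_any_run_true h4 hx hk h1 hl hm hp r1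
  obtain ⟨o4, c4⟩ := h.cls_of_any_run_true h4 hx hk h1 hl hm hq r2
  have := h4 _ _ _ _ _ _ _ _ _ _ c1 c2 c3 c4
  have hj0 := r1.pos
  have hmk : 0 < m * k := Nat.mul_pos hm.pos (by omega)
  have hprod : j ≠ 1 → (j - 2) * (l₂ + k) < (j' - 2) * (l₂ + k) := fun _ =>
    Nat.mul_lt_mul_of_pos_right (by omega) (by omega)
  split_ifs at this <;> omega

end Coded

/-- If all runs of zeros have the same length `k ≥ 2` and the runs of ones have one of two
lengths, then some factor has four abelian returns. -/
theorem not_noFour_of_runs {x : ℕ → Bool} {k l₁ l₂ : ℕ} (hx : ¬ UltimatelyPeriodic x) (hk : 2 ≤ k)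
    (hl : l₁ < l₂) (h0 : ∀ p j, Run x false p j → j = k)
    (h1 : ∀ p j, Run x true p j → j = l₁ ∨ j = l₂) (hl₁ : 1 ≤ l₁) : ¬ NoFour x := by
  set B : Bool → ℕ := fun b => if b then l₂ else l₁ with hB
  obtain ⟨p₀, j₀, -, hp₀⟩ := exists_run_ge hx true 0
  obtain ⟨v, s, -, hv⟩ := exists_coding (P := fun p => ∃ q l, p = q + 1 ∧ Run x true q l)
    (Q := fun b p => (∀ r < B b, x (p + r) = true) ∧ ∀ r < k, x (p + B b + r) = false)
    (len := fun b => B b + k) ⟨p₀, j₀, rfl, hp₀⟩ (by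
      rintro _ ⟨q, l, rfl, hr⟩
      obtain ⟨b, rfl⟩ : ∃ b, l = B b := by
        rcases h1 _ _ hr with rfl | rfl
        · exact ⟨false, by simp [hB]⟩
        · exact ⟨true, by simp [hB]⟩
      obtain ⟨j, hj⟩ := hr.next hx
      obtain rfl := h0 _ _ hj
      obtain ⟨l', hl'⟩ := hj.next hx
      exact ⟨b, ⟨hr.mid, fun r h => hj.at (by omega) (by omega)⟩, _, l', by omega, hl'⟩)
  have hvx : ¬ UltimatelyPeriodic v := fun h => hx <| UltimatelyPeriodic.of_coding (s := s)
    (len := fun b => B b + k)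
    (fun b r => decide (r < B b)) (fun b => by omega) (fun t => (hv t).2.2) (fun t r hr => by
      rcases lt_or_ge r (B (v t)) with h | h
      · simp [h, (hv t).2.1.1 r h]
      · have := (hv t).2.1.2 (r - B (v t)) (by omega)
        rw [show s t + B (v t) + (r - B (v t)) = s t + r by omega] at this
        simp [this, h]) h
  refine Coded.not_noFour (v := v) (e := s) (L := fun t => B (v t)) (k := k) (l₁ := l₁) (l₂ := l₂)
    ⟨fun t ht => by simp [hB, ht], fun t ht => by simp [hB, ht],
      fun t => by rw [(hv t).2.2, add_assoc], fun t p hp hpe => ?_⟩ hvx hk hl₁ hl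
  obtain ⟨r, rfl⟩ := Nat.exists_eq_add_of_le hp
  have hone : ∀ r ≤ B (v t), cnt x (s t) r = r := fun r hr => by
    rw [cnt_const (b := true) fun u hu => (hv t).2.1.1 u (by omega)]; simp
  rw [cnt_add, zero_add, Nat.add_sub_cancel_left]
  rcases le_total r (B (v t)) with h | h
  · rw [hone r h, min_eq_left h]
  · obtain ⟨r, rfl⟩ := Nat.exists_eq_add_of_le h
    rw [cnt_add, hone _ le_rfl, min_eq_right h,
      cnt_const (b := false) fun u hu => (hv t).2.1.2 u (by omega)]
    simp

theorem cls_of_period_three {v : ℕ → Bool} {i : ℕ} (h : v (i + 3) = v i) :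
    Cls v 3 (cnt v i 3) 1 (v i).toNat := by
  refine ⟨i, ⟨one_pos, rfl, ?_, by omega⟩, cnt_one _ _⟩
  rw [cnt_three, cnt_three, add_assoc i 1 2, h, add_assoc i 1 1]
  omega

/-- The factor `b c d b` with `c ≠ d` occurs. -/
def HasTurn (v : ℕ → Bool) (b : Bool) : Prop :=
  ∃ i, v i = b ∧ v (i + 3) = b ∧ v (i + 1) ≠ v (i + 2)

theorem HasTurn.compl {v : ℕ → Bool} {b : Bool} :
    HasTurn (fun i => !v i) b ↔ HasTurn v (!b) := by
  unfold HasTurn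
  refine exists_congr fun i => ?_
  beta_reduce
  generalize v i = a₀, v (i + 1) = a₁, v (i + 2) = a₂, v (i + 3) = a₃
  revert a₀ a₁ a₂ a₃ b
  decide

theorem HasTurn.cls {v : ℕ → Bool} {b : Bool} (h : HasTurn v b) :
    Cls v 3 (1 + b.toNat) 1 b.toNat := by
  obtain ⟨i, rfl, h3, hne⟩ := h
  have h1 := cls_of_period_three h3
  have h2 : cnt v i 3 = 1 + (v i).toNat := by
    rw [cnt_three]
    revert hne
    cases v (i + 1) <;> cases v (i + 2) <;> simp <;> omega
  rwa [h2] at h1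

theorem Run.cls_three {v : ℕ → Bool} {b : Bool} {p : ℕ} (h : Run v b p 2) :
    Cls v 3 (1 + b.toNat) 1 (!b).toNat := by
  have h1 := cls_of_period_three (v := v) (i := p) (by rw [h.left]; exact h.right)
  have h2 : cnt v p 3 = 1 + b.toNat := by
    rw [cnt_three, h.left, h.at (q := p + 1) (by omega) (by omega),
      h.at (q := p + 2) (by omega) (by omega)]
    cases b <;> rfl
  rwa [h2, h.left] at h1

theorem ultPer_of_not_hasTurn {v : ℕ → Bool} (h3 : ∀ t, v t = v (t + 1) → v (t + 2) ≠ v t)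
    (h : ∀ b, ¬ HasTurn v b) {p : ℕ} {b : Bool} (hr : Run v b p 2) : UltimatelyPeriodic v := by
  have key : ∀ s, v (p + 1 + s + 2) = !v (p + 1 + s) := by
    intro s
    induction s with
    | zero =>
      rw [add_zero, hr.at (q := p + 1) (by omega) (by omega)]
      exact hr.right
    | succ s ih =>
      have h1 := h3 (p + 1 + s + 1)
      have h2 : ¬ _ := fun hc => h (v (p + 1 + s)) ⟨p + 1 + s, rfl, hc⟩
      rw [← add_assoc]
      rw [add_assoc _ 1 1, add_assoc _ 1 2] at h1
      rw [add_assoc _ 1 2]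
      simp only [Nat.reduceAdd] at *
      revert h1 h2 ih
      generalize v (p + 1 + s) = a
      generalize v (p + 1 + s + 1) = b
      generalize v (p + 1 + s + 2) = c
      generalize v (p + 1 + s + 3) = d
      revert a b c d
      decide
  refine ⟨p + 1, 4, by omega, fun n hn => ?_⟩
  obtain ⟨s, rfl⟩ := Nat.exists_eq_add_of_le hn
  have h1 := key s
  have h2 := key (s + 2)
  rw [show p + 1 + (s + 2) + 2 = p + 1 + s + 4 by omega, ← add_assoc, h1] at h2
  simpa using h2

theorem hasTurn_of_hasTurn {v : ℕ → Bool} (h4 : NoFour v)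
    (hr : ∀ b k, k = 1 ∨ k = 2 → ∃ p, 1 ≤ p ∧ Run v b p k) (ht : HasTurn v true) :
    HasTurn v false := by
  by_contra hf
  have hno : ∀ i, v i = false → v (i + 3) = false → v (i + 1) = v (i + 2) := fun i h1 h2 => by
    by_contra hne
    exact hf ⟨i, h1, h2, hne⟩
  obtain ⟨p1, -, r1⟩ := hr true 2 (by simp)
  have c1 := r1.cls_three
  have c2 := ht.cls
  obtain ⟨p3, h3, r3⟩ := hr false 2 (by simp)
  obtain ⟨q3, rfl⟩ : ∃ q, p3 = q + 1 := ⟨p3 - 1, by omega⟩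
  have e0 := hno q3
  have e1 : v (q3 + 1) = true := r3.left
  have e2 : v (q3 + 2) = false := r3.at (by omega) (by omega)
  have e3 : v (q3 + 3) = false := r3.at (by omega) (by omega)
  have e4 : v (q3 + 4) = true := r3.at_end (by omega)
  have e5 := hno (q3 + 2)
  simp only [add_assoc, Nat.reduceAdd, e1, e2, e3, e4] at e0 e5
  have e0 : v q3 = true := by revert e0; cases v q3 <;> simp
  have e5 : v (q3 + 5) = true := by revert e5; cases v (q3 + 5) <;> simp
  have c3 : Cls v 3 2 3 2 := by
    refine ⟨q3, ⟨by omega, ?_, ?_, fun d d0 d1 => ?_⟩, ?_⟩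
    · rw [cnt_three, e0, e1, e2]; rfl
    · rw [cnt_three, e3, add_assoc, add_assoc, e4, e5]; rfl
    · obtain rfl | rfl : d = 1 ∨ d = 2 := by omega
      · rw [cnt_three, e1, add_assoc, add_assoc, e2, e3]; decide
      · rw [cnt_three, e2, add_assoc, add_assoc, e3, e4]; decide
    · rw [cnt_three, e0, e1, e2]; rfl
  obtain ⟨p4, h4', r4⟩ := hr true 1 (by simp)
  obtain ⟨q4, rfl⟩ : ∃ q, p4 = q + 1 := ⟨p4 - 1, by omega⟩
  have g0 := hno q4
  have g1 : v (q4 + 1) = false := r4.left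
  have g2 : v (q4 + 2) = true := r4.at (by omega) (by omega)
  have g3 : v (q4 + 3) = false := r4.at_end (by omega)
  have g4 := hno (q4 + 1)
  simp only [add_assoc, Nat.reduceAdd, g1, g2, g3] at g0 g4
  have g0 : v q4 = true := by revert g0; cases v q4 <;> simp
  have g4 : v (q4 + 4) = true := by revert g4; cases v (q4 + 4) <;> simp
  have c4 : Cls v 3 2 2 1 := by
    refine ⟨q4, ⟨by omega, ?_, ?_, fun d d0 d1 => ?_⟩, ?_⟩
    · rw [cnt_three, g0, g1, g2]; rfl
    · rw [cnt_three, g2, add_assoc, add_assoc, g3, g4]; rfl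
    · obtain rfl : d = 1 := by omega
      rw [cnt_three, g1, add_assoc, add_assoc, g2, g3]; decide
    · rw [cnt_two, g0, g1]; rfl
  have := h4 _ _ _ _ _ _ _ _ _ _ c1 c2 c3 c4
  simp at this

theorem UltimatelyPeriodic.of_cnt_three {v g : ℕ → Bool} (hg : ∀ i, cnt v i 3 = 1 + (g i).toNat)
    (h : UltimatelyPeriodic g) : UltimatelyPeriodic v := by
  obtain ⟨N, T, hT, hp⟩ := h
  have hf : ∀ i, N ≤ i → cnt v (i + T) 3 = cnt v i 3 := fun i hi => by rw [hg, hg, hp i hi]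
  have hstep : ∀ i, cnt v i 3 + (v (i + 3)).toNat = (v i).toNat + cnt v (i + 1) 3 := fun i => by
    rw [cnt_three, cnt_three, add_assoc i 1 2, add_assoc i 1 1]
    omega
  have key : ∀ i, N ≤ i → ∀ m, (v (i + 3 * m)).toNat + (v (i + T)).toNat
      = (v i).toNat + (v (i + T + 3 * m)).toNat := by
    intro i hi m
    induction m with
    | zero => simp
    | succ m ih =>
      have h1 := hstep (i + 3 * m)
      have h2 := hstep (i + T + 3 * m)
      have h3 := hf (i + 3 * m) (by omega)
      have h4 := hf (i + 3 * m + 1) (by omega)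
      rw [show i + 3 * m + T = i + T + 3 * m by omega] at h3
      rw [show i + 3 * m + 1 + T = i + T + 3 * m + 1 by omega] at h4
      rw [show i + 3 * (m + 1) = i + 3 * m + 3 by omega,
        show i + T + 3 * (m + 1) = i + T + 3 * m + 3 by omega]
      omega
  refine ⟨N, 3 * T, by omega, fun n hn => ?_⟩
  have h1 := key n hn T
  have h2 := key (n + T) (by omega) T
  have h3 := key (n + T + T) (by omega) T
  rw [show n + T + T + T = n + 3 * T by omega] at h3
  have hb := Bool.toNat_le (v (n + 3 * T + 3 * T))
  have hb' := Bool.toNat_le (v (n + 3 * T))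
  have hb'' := Bool.toNat_le (v n)
  have : (v (n + 3 * T)).toNat = (v n).toNat := by omega
  revert this
  cases v (n + 3 * T) <;> cases v n <;> simp

/-- A word without cubes of letters, with runs of lengths one and two of both letters, has a
factor with four abelian returns. -/
theorem not_noFour_of_no_cube {v : ℕ → Bool} (hv : ¬ UltimatelyPeriodic v)
    (h3 : ∀ t, v t = v (t + 1) → v (t + 2) ≠ v t)
    (hr : ∀ b k, k = 1 ∨ k = 2 → ∃ p, 1 ≤ p ∧ Run v b p k) : ¬ NoFour v := by
  intro h4
  have hr' : ∀ b k, k = 1 ∨ k = 2 → ∃ p, 1 ≤ p ∧ Run (fun i => !v i) b p k := fun b k hk => by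
    obtain ⟨p, hp, h⟩ := hr (!b) k hk
    refine ⟨p, hp, ?_⟩
    have : Run (fun i => !(fun i => !v i) i) (!b) p k := by simpa using h
    simpa using this.compl
  have hturn : ∀ b, HasTurn v b := by
    obtain ⟨p, -, h⟩ := hr true 2 (by simp)
    have hex : ∃ b, HasTurn v b := by
      by_contra! hc
      exact hv (ultPer_of_not_hasTurn h3 hc h)
    have h1 : HasTurn v true → HasTurn v false := hasTurn_of_hasTurn h4 hr
    have h2 : HasTurn v false → HasTurn v true := fun h => by
      have := hasTurn_of_hasTurn h4.compl hr' (HasTurn.compl.2 (by simpa using h))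
      simpa using HasTurn.compl.1 this
    obtain ⟨b, hb⟩ := hex
    intro b'
    cases b <;> cases b' <;> simp_all
  set g : ℕ → Bool := fun i => decide (cnt v i 3 = 2) with hgdef
  have hg : ∀ i, cnt v i 3 = 1 + (g i).toNat := fun i => by
    have := h3 i
    simp only [hgdef]
    rw [cnt_three]
    revert this
    cases v i <;> cases v (i + 1) <;> cases v (i + 2) <;> simp
  have hg' : ¬ UltimatelyPeriodic g := fun h => hv (h.of_cnt_three hg)
  have hcls : ∀ b p k, Run g b p k → ∃ o, Cls v 3 (1 + (!b).toNat) (k + 1) o := fun b p k h => by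
    refine ⟨_, p, ⟨by omega, by rw [hg, h.left], ?_, fun e e0 e1 => ?_⟩, rfl⟩
    · rw [hg, h.at_end (by omega)]
    · rw [hg, h.at (by omega) (by omega)]
      cases b <;> decide
  obtain ⟨b, p, k, q, l, hkl, r1, r2⟩ := exists_two_runs hg'
  obtain ⟨o1, c1⟩ := hcls _ _ _ r1
  obtain ⟨o2, c2⟩ := hcls _ _ _ r2
  obtain ⟨r, -, r3⟩ := hr (!b) 2 (by simp)
  have := h4 _ _ _ _ _ _ _ _ _ _ c1 c2 (hturn (!b)).cls r3.cls_three
  have hk := r1.pos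
  have hb : (!b).toNat ≠ (!!b).toNat := by cases b <;> decide
  omega

/-- The word `x` is, from position `s 0` on, the image of `v` under the substitution
`b ↦ b ^ len b`. -/
structure Subst (x v : ℕ → Bool) (s : ℕ → ℕ) (len : Bool → ℕ) : Prop where
  pos : ∀ b, 0 < len b
  step : ∀ t, s (t + 1) = s t + len (v t)
  val : ∀ t, ∀ u < len (v t), x (s t + u) = v t

theorem mul_add_inj {m a b r r' : ℕ} (hr : r < m) (hr' : r' < m) (h : m * a + r = m * b + r') :
    a = b ∧ r = r' := by
  have h1 : (m * a + r) / m = a := by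
    rw [Nat.mul_add_div (by omega), Nat.div_eq_of_lt hr, add_zero]
  have h2 : (m * b + r') / m = b := by
    rw [Nat.mul_add_div (by omega), Nat.div_eq_of_lt hr', add_zero]
  have : a = b := by rw [← h1, h, h2]
  subst this
  exact ⟨rfl, by omega⟩

namespace Subst

variable {x v : ℕ → Bool} {s : ℕ → ℕ} {len : Bool → ℕ}

theorem lt_succ (h : Subst x v s len) (t : ℕ) : s t < s (t + 1) := by
  have := h.pos (v t)
  have := h.step t
  omega

theorem cnt_eq (h : Subst x v s len) (t : ℕ) :
    cnt x 0 (s t) = cnt x 0 (s 0) + len true * cnt v 0 t := by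
  induction t with
  | zero => simp
  | succ t ih =>
    rw [h.step, cnt_add, ih, zero_add, cnt_const (h.val t), cnt_succ, zero_add, mul_add, add_assoc]
    cases v t <;> simp

theorem start_eq (h : Subst x v s len) (t : ℕ) :
    s t = s 0 + len true * cnt v 0 t + len false * cnt (fun i => !v i) 0 t := by
  induction t with
  | zero => simp
  | succ t ih =>
    rw [h.step, ih, cnt_succ, cnt_succ, zero_add]
    cases v t <;> simp [mul_add] <;> omega

/-- A position inside a block. -/
theorem exists_pos (h : Subst x v s len) {N p : ℕ} (hp : s N ≤ p) :
    ∃ t r, N ≤ t ∧ p = s t + r ∧ r < len (v t) := by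
  obtain ⟨t, ht, h1, h2⟩ := exists_block h.lt_succ hp
  have := h.step t
  exact ⟨t, p - s t, ht, by omega, by omega⟩

theorem cnt_pos (h : Subst x v s len) {t r : ℕ} (hr : r < len (v t)) :
    cnt x 0 (s t + r) = cnt x 0 (s 0) + len true * cnt v 0 t + (if v t then r else 0) := by
  rw [cnt_add, h.cnt_eq, zero_add, cnt_const fun u hu => h.val t u (by omega)]
  cases v t <;> simp

theorem level (h : Subst x v s len) {c z t r : ℕ} (hr : r < len (v t))
    (hl : cnt x 0 (s t + r + (len true * c + len false * z))
      = cnt x 0 (s t + r) + len true * c) :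
    cnt v 0 (t + (c + z)) = cnt v 0 t + c ∧ (0 < r → v (t + (c + z)) = v t) := by
  obtain ⟨t', r', -, e, hr'⟩ := h.exists_pos (N := t)
    (p := s t + r + (len true * c + len false * z)) (by omega)
  rw [e, h.cnt_pos hr, h.cnt_pos hr'] at hl
  rw [h.start_eq t, h.start_eq t'] at e
  have n1 := cnt_not v 0 t
  have n2 := cnt_not v 0 t'
  have pf := h.pos false
  have pt := h.pos true
  have key : ∀ b (r : ℕ), r < len b → (if b then r else 0) < len true ∧
      (if b then 0 else r) < len false ∧ (if b then r else 0) + (if b then 0 else r) = r := by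
    intro b r hr
    cases b <;> simp [*]
  obtain ⟨k1, k2, k3⟩ := key _ _ hr
  obtain ⟨k1', k2', k3'⟩ := key _ _ hr'
  obtain ⟨a1, a2⟩ := mul_add_inj (a := cnt v 0 t') (b := cnt v 0 t + c) k1' k1
    (by rw [mul_add]; omega)
  obtain ⟨b1, b2⟩ := mul_add_inj (a := cnt (fun i => !v i) 0 t')
    (b := cnt (fun i => !v i) 0 t + z) k2' k2 (by rw [mul_add]; omega)
  obtain rfl : t' = t + (c + z) := by omega
  refine ⟨a1, fun h0 => ?_⟩
  revert a2 b2
  cases v t <;> cases v (t + (c + z)) <;> simp <;> omega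

theorem start_add (h : Subst x v s len) {c z t : ℕ}
    (hl : cnt v 0 (t + (c + z)) = cnt v 0 t + c) :
    s (t + (c + z)) = s t + (len true * c + len false * z) := by
  have n1 := cnt_not v 0 t
  have n2 := cnt_not v 0 (t + (c + z))
  rw [h.start_eq t, h.start_eq, hl, show cnt (fun i => !v i) 0 (t + (c + z))
    = cnt (fun i => !v i) 0 t + z by omega, mul_add, mul_add]
  omega

theorem cls_of_ret (h : Subst x v s len) {c z i d : ℕ} (hr : Ret v (c + z) c i d) :
    ∃ d' o', Cls x (len true * c + len false * z) (len true * c) d' o' ∧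
      ((d = 1 ∧ d' = 1 ∧ o' = cnt v i d) ∨ (2 ≤ d ∧ 2 ≤ d' ∧ o' = len true * cnt v i d ∧
        d' = len true * cnt v i d + len false * cnt (fun j => !v j) i d)) := by
  have lev : ∀ j, cnt v 0 (j + (c + z)) = cnt v 0 j + c ↔ cnt v j (c + z) = c := fun j => by
    rw [cnt_add, zero_add]; omega
  have hd := hr.pos
  have hO : ∀ j, cnt v 0 (j + (c + z)) = cnt v 0 j + c →
      cnt x 0 (s j + (len true * c + len false * z)) = cnt x 0 (s j) + len true * c :=
    fun j hj => by
      rw [← h.start_add hj, h.cnt_eq, h.cnt_eq j, hj, mul_add, add_assoc]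
  have l0 := (lev i).2 hr.start
  have l1 := (lev (i + d)).2 hr.finish
  have hx0 : ∀ t, x (s t) = v t := fun t => h.val t 0 (h.pos _)
  rcases eq_or_lt_of_le (Nat.succ_le_of_lt hd) with hd1 | hd2
  · obtain rfl : d = 1 := hd1.symm
    have hv : v (i + (c + z)) = v i := by
      rw [show i + 1 + (c + z) = i + (c + z) + 1 by omega, cnt_succ, cnt_succ, l0] at l1
      simp only [zero_add] at l1
      revert l1
      cases v (i + (c + z)) <;> cases v i <;> simp
    refine ⟨1, cnt v i 1, ?_, Or.inl ⟨rfl, rfl, rfl⟩⟩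
    have := Cls.of_prefix (x := x) (n := len true * c + len false * z) (c := len true * c)
      (i := s i) (j := s i + 1) (by omega) (hO i l0) (by
        rw [show s i + 1 + (len true * c + len false * z)
          = s i + (len true * c + len false * z) + 1 by omega, cnt_succ, cnt_succ, hO i l0,
          ← h.start_add l0]
        simp only [zero_add]
        rw [hx0, hx0, hv]
        omega) (fun p _ _ => by omega)
    convert this using 1
    · omega
    · rw [cnt_succ x 0 (s i), zero_add, hx0, cnt_one]
      omega
  · have hmono : StrictMono s := strictMono_nat_of_lt_succ h.lt_succ
    have hno : ∀ t, i < t → t < i + d → cnt v 0 (t + (c + z)) ≠ cnt v 0 t + c := by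
      intro t h1 h2 hc
      have := hr.mid (t - i) (by omega) (by omega)
      rw [show i + (t - i) = t by omega] at this
      exact this ((lev t).1 hc)
    have hC := Cls.of_prefix (hmono (show i < i + d by omega)) (hO i l0) (hO (i + d) l1)
      fun p p1 p2 hp => by
        obtain ⟨t, r, ht, rfl, hrt⟩ := h.exists_pos p1.le
        have htd : t < i + d := by
          by_contra! hc
          have := hmono.monotone hc
          omega
        obtain ⟨g1, g2⟩ := h.level hrt hp
        have hit : i = t := by
          by_contra hne
          exact hno t (by omega) htd g1
        subst hit
        refine hno (i + 1) (by omega) (by omega) ?_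
        rw [show i + 1 + (c + z) = i + (c + z) + 1 by omega, cnt_succ, cnt_succ, g1, zero_add,
          zero_add, g2 (by omega)]
        omega
    have e1 : s (i + d) - s i = len true * cnt v i d + len false * cnt (fun j => !v j) i d := by
      rw [h.start_eq i, h.start_eq, cnt_add, cnt_add, mul_add, mul_add, zero_add]
      omega
    have e2 : cnt x 0 (s (i + d)) - cnt x 0 (s i) = len true * cnt v i d := by
      rw [h.cnt_eq i, h.cnt_eq, cnt_add, mul_add, zero_add]
      omega
    have e3 : 2 ≤ s (i + d) - s i := by
      have h1 := hmono (show i < i + 1 by omega)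
      have h2 := hmono (show i + 1 < i + d by omega)
      omega
    exact ⟨_, _, hC, Or.inr ⟨hd2, e3, e2, e1⟩⟩

theorem noFour (h : Subst x v s len) (h4 : NoFour x) : NoFour v := by
  intro n c d₁ o₁ d₂ o₂ d₃ o₃ d₄ o₄ h₁ h₂ h₃ h₄
  obtain ⟨i₁, h₁, rfl⟩ := h₁
  obtain ⟨i₂, h₂, rfl⟩ := h₂
  obtain ⟨i₃, h₃, rfl⟩ := h₃
  obtain ⟨i₄, h₄, rfl⟩ := h₄
  obtain ⟨z, rfl⟩ := Nat.exists_eq_add_of_le (h₁.start ▸ cnt_le v i₁ n : c ≤ n)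
  obtain ⟨_, _, c₁, k₁⟩ := h.cls_of_ret h₁
  obtain ⟨_, _, c₂, k₂⟩ := h.cls_of_ret h₂
  obtain ⟨_, _, c₃, k₃⟩ := h.cls_of_ret h₃
  obtain ⟨_, _, c₄, k₄⟩ := h.cls_of_ret h₄
  have key : ∀ {i d d' o' j f f' p' : ℕ},
      ((d = 1 ∧ d' = 1 ∧ o' = cnt v i d) ∨ (2 ≤ d ∧ 2 ≤ d' ∧ o' = len true * cnt v i d ∧
        d' = len true * cnt v i d + len false * cnt (fun j => !v j) i d)) →
      ((f = 1 ∧ f' = 1 ∧ p' = cnt v j f) ∨ (2 ≤ f ∧ 2 ≤ f' ∧ p' = len true * cnt v j f ∧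
        f' = len true * cnt v j f + len false * cnt (fun i => !v i) j f)) →
      d' = f' ∧ o' = p' → d = f ∧ cnt v i d = cnt v j f := by
    intro i d d' o' j f f' p' hd hf ⟨e1, e2⟩
    rcases hd with ⟨a1, a2, a3⟩ | ⟨a1, a2, a3, a4⟩ <;>
      rcases hf with ⟨b1, b2, b3⟩ | ⟨b1, b2, b3, b4⟩ <;> try omega
    have q1 := Nat.eq_of_mul_eq_mul_left (h.pos true) (a3.symm.trans (e2.trans b3))
    have q2 : cnt (fun j => !v j) i d = cnt (fun i => !v i) j f :=
      Nat.eq_of_mul_eq_mul_left (h.pos false) (by omega)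
    have := cnt_not v i d
    have := cnt_not v j f
    omega
  exact (h4 _ _ _ _ _ _ _ _ _ _ c₁ c₂ c₃ c₄).imp (key k₁ k₂) <| Or.imp (key k₁ k₃) <|
    Or.imp (key k₁ k₄) <| Or.imp (key k₂ k₃) <| Or.imp (key k₂ k₄) (key k₃ k₄)

theorem ultPer (h : Subst x v s len) (hv : UltimatelyPeriodic v) : UltimatelyPeriodic x :=
  hv.of_coding (fun b _ => b) h.pos h.step h.val

theorem start_of_run (h : Subst x v s len) {b : Bool} {p k : ℕ} (hr : Run x b p k)
    (hp : s 1 ≤ p) : ∃ t, 1 ≤ t ∧ s (t + 1) = p + 1 ∧ v t = !b := by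
  obtain ⟨t, r, ht, rfl, hrt⟩ := h.exists_pos hp
  have hv : v t = !b := by rw [← h.val t r hrt]; exact hr.left
  refine ⟨t, ht, ?_, hv⟩
  rw [h.step]
  by_contra hne
  have h1 := h.val t (r + 1) (by omega)
  have h2 := hr.at (q := s t + (r + 1)) (by omega) (by have := hr.pos; omega)
  rw [h2, hv] at h1
  cases b <;> simp at h1

theorem run (h : Subst x v s len) {b : Bool} {p r : ℕ} (h12 : r = 1 ∨ r = 2)
    (hr : Run x b p (r * len b)) (hp : s 1 ≤ p) : ∃ t, 1 ≤ t ∧ Run v b t r := by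
  have hx0 : ∀ t, x (s t) = v t := fun t => h.val t 0 (h.pos _)
  obtain ⟨t, ht, hs, hv⟩ := h.start_of_run hr hp
  have hb := h.pos b
  have v1 : v (t + 1) = b := by
    rw [← hx0, hs]; exact hr.at (by omega) (by have := hr.pos; omega)
  have s2 : s (t + 2) = p + 1 + len b := by
    rw [show t + 2 = t + 1 + 1 by omega, h.step, v1, hs]
  refine ⟨t, ht, ?_⟩
  rcases h12 with rfl | rfl
  · refine ⟨le_rfl, hv, fun u hu => ?_, ?_⟩
    · obtain rfl : u = 0 := by omega
      exact v1
    · rw [← hx0, show t + 1 + 1 = t + 2 by omega, s2]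
      exact hr.at_end (by omega)
  · have v2 : v (t + 2) = b := by rw [← hx0, s2]; exact hr.at (by omega) (by omega)
    refine ⟨by omega, hv, fun u hu => ?_, ?_⟩
    · obtain rfl | rfl : u = 0 ∨ u = 1 := by omega
      · exact v1
      · exact v2
    · rw [← hx0, show t + 1 + 2 = t + 2 + 1 by omega, h.step, v2, s2]
      exact hr.at_end (by omega)

end Subst

/-- If the runs of each letter `b` have the lengths `len b` and `2 * len b`, then some factor has
four abelian returns. -/
theorem not_noFour_of_double {x : ℕ → Bool} (len : Bool → ℕ) (hx : ¬ UltimatelyPeriodic x)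
    (hrec : RunRec x)
    (hrun : ∀ b p k, Run x b p k → k = len b ∨ k = 2 * len b)
    (hex : ∀ b r, r = 1 ∨ r = 2 → ∃ p, Run x b p (r * len b)) : ¬ NoFour x := by
  intro h4
  have hpos : ∀ b, 0 < len b := fun b => by
    obtain ⟨p, hp⟩ := hex b 1 (by simp)
    have := hp.pos
    omega
  have hstart : ∀ b p k, Run x b p k → ∃ b r, (r = 1 ∨ r = 2) ∧
      (∀ u < r * len b, x (p + 1 + u) = b) ∧ x (p + 1 + r * len b) = !b := by
    intro b p k h
    rcases hrun b p k h with rfl | rfl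
    · exact ⟨b, 1, by simp, by simpa using h.mid, by simpa using h.right⟩
    · exact ⟨b, 2, by simp, h.mid, h.right⟩
  obtain ⟨p₀, hp₀⟩ := hex true 1 (by simp)
  obtain ⟨v, s, -, hv⟩ := exists_coding
    (P := fun p => ∃ b r, (r = 1 ∨ r = 2) ∧ (∀ u < r * len b, x (p + u) = b) ∧
      x (p + r * len b) = !b)
    (Q := fun b p => ∀ u < len b, x (p + u) = b) (len := len) (hstart _ _ _ hp₀) (by
      rintro p ⟨b, r, rfl | rfl, h1, h2⟩
      · rw [one_mul] at h1 h2
        refine ⟨b, h1, ?_⟩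
        have := hpos b
        obtain ⟨k, hk⟩ := exists_run_of hx (b := !b) (p := p + (len b - 1))
          (by rw [h1 _ (by omega), Bool.not_not])
          (by rw [show p + (len b - 1) + 1 = p + len b by omega]; exact h2)
        have := hstart _ _ _ hk
        rwa [show p + (len b - 1) + 1 = p + len b by omega] at this
      · exact ⟨b, fun u hu => h1 u (by omega), b, 1, by simp,
          fun u hu => by rw [add_assoc]; exact h1 _ (by omega),
          by rw [show p + len b + 1 * len b = p + 2 * len b by omega]; exact h2⟩)
  have hS : Subst x v s len := ⟨hpos, fun t => (hv t).2.2, fun t => (hv t).2.1⟩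
  refine not_noFour_of_no_cube (fun h => hx (hS.ultPer h)) (fun t h1 h2 => ?_) (fun b r h12 => ?_)
    (hS.noFour h4)
  · obtain ⟨b, r, h12, g1, g2⟩ := (hv t).1
    have hb := hpos b
    have hvb : v t = b := by
      rw [← hS.val t 0 (hpos _)]
      exact g1 0 (by rcases h12 with rfl | rfl <;> omega)
    have e1 := hS.step t
    have e2 := hS.step (t + 1)
    have c1 := hS.val (t + 1) 0 (hpos _)
    have c2 := hS.val (t + 2) 0 (hpos _)
    rw [← h1, hvb] at e2 c1
    rw [hvb] at e1 h2
    rw [h2] at c2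
    rw [show t + 1 + 1 = t + 2 by omega] at e2
    rcases h12 with rfl | rfl
    · rw [e1, show s t + len b + 0 = s t + 1 * len b by omega, g2] at c1
      cases b <;> simp at c1
    · rw [e2, e1, show s t + len b + len b + 0 = s t + 2 * len b by omega, g2] at c2
      cases b <;> simp at c2
  · obtain ⟨p, hp⟩ := hex b r h12
    obtain ⟨q, hq, hr⟩ := hrec b p _ (s 1) hp
    exact hS.run h12 hr hq

theorem Run.to_compl {x : ℕ → Bool} {b : Bool} {p k : ℕ} (h : Run x b p k) :
    Run (fun i => !x i) (!b) p k := by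
  have : Run (fun i => !(fun i => !x i) i) b p k := by simpa using h
  exact this.compl

/-- If the letter `true` is not isolated, the runs of `false` have at most two lengths. -/
theorem run_false_eq_or {x : ℕ → Bool} (h4 : NoFour x) {p l : ℕ} (h : Run x true p l)
    (hl : 2 ≤ l) {q₁ k₁ q₂ k₂ : ℕ} (h1 : Run x false q₁ k₁) (h2 : Run x false q₂ k₂)
    (hne : k₁ ≠ k₂) {q k : ℕ} (hq : Run x false q k) : k = k₁ ∨ k = k₂ := by
  have := h4 _ _ _ _ _ _ _ _ _ _ (cls_one_of_run h1) (cls_one_of_run h2) (cls_one_of_run hq)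
    (cls_one_of_pair h hl)
  have := h1.pos
  have := h2.pos
  have := hq.pos
  omega

theorem run_true_eq_or {x : ℕ → Bool} (h4 : NoFour x) {p l : ℕ} (h : Run x false p l)
    (hl : 2 ≤ l) {q₁ k₁ q₂ k₂ : ℕ} (h1 : Run x true q₁ k₁) (h2 : Run x true q₂ k₂)
    (hne : k₁ ≠ k₂) {q k : ℕ} (hq : Run x true q k) : k = k₁ ∨ k = k₂ :=
  run_false_eq_or h4.compl h.to_compl hl h1.to_compl h2.to_compl hne hq.to_compl

/-- If the runs of `true` have lengths `2` and `l ≠ 2`, then `l = 1` or `l = 4`. -/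
theorem eq_one_or_four {x : ℕ → Bool} (hx : ¬ UltimatelyPeriodic x) (h4 : NoFour x)
    (hrec : RunRec x)
    {p₁ p₂ q₁ q₂ l k : ℕ} (h1 : Run x true p₁ 2) (h2 : Run x true p₂ l) (hl : l ≠ 2)
    (h3 : Run x false q₁ 2) (h5 : Run x false q₂ k) (hk : k ≠ 2) : l = 1 ∨ l = 4 := by
  have := h2.pos
  rcases (show l = 1 ∨ 3 ≤ l by omega) with h | h
  · exact Or.inl h
  · refine Or.inr (eq_four_of_runs hx h4 hrec (fun p m hm => ?_) h1 h2 h h3 h5 hk)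
    have := run_true_eq_or h4 h3 le_rfl h1 h2 (by omega) hm
    omega

/-- Run lengths `2, k` and `2, l` for the two letters are impossible. -/
theorem not_noFour_of_two {x : ℕ → Bool} (hx : ¬ UltimatelyPeriodic x) (hrec : RunRec x)
    {p₁ p₂ q₁ q₂ l k : ℕ} (h1 : Run x true p₁ 2) (h2 : Run x true p₂ l) (hl : l ≠ 2)
    (h3 : Run x false q₁ 2) (h5 : Run x false q₂ k) (hk : k ≠ 2) : ¬ NoFour x := by
  intro h4
  have e1 := eq_one_or_four hx h4 hrec h1 h2 hl h3 h5 hk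
  have e2 := eq_one_or_four (fun h => hx h.compl) h4.compl hrec.compl h3.to_compl h5.to_compl hk
    h1.to_compl h2.to_compl hl
  obtain ⟨β, hβ⟩ : ∃ β, (β = 1 ∧ l = 1) ∨ (β = 2 ∧ l = 4) := by
    rcases e1 with h | h
    · exact ⟨1, by omega⟩
    · exact ⟨2, by omega⟩
  obtain ⟨α, hα⟩ : ∃ α, (α = 1 ∧ k = 1) ∨ (α = 2 ∧ k = 4) := by
    rcases e2 with h | h
    · exact ⟨1, by omega⟩
    · exact ⟨2, by omega⟩
  refine not_noFour_of_double (fun b => if b then β else α) hx hrec ?_ ?_ h4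
  · rintro (_ | _) p m hm
    · have := run_false_eq_or h4 h1 le_rfl h3 h5 (by omega) hm
      simp only [Bool.false_eq_true, if_false]; omega
    · have := run_true_eq_or h4 h3 le_rfl h1 h2 (by omega) hm
      simp only [if_true]; omega
  · rintro (_ | _) r hr
    · simp only [Bool.false_eq_true, if_false]
      rcases (show r * α = 2 ∨ r * α = k by rcases hr with rfl | rfl <;> omega) with h | h
      · exact ⟨_, h ▸ h3⟩
      · exact ⟨_, h ▸ h5⟩
    · simp only [if_true]
      rcases (show r * β = 2 ∨ r * β = l by rcases hr with rfl | rfl <;> omega) with h | h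
      · exact ⟨_, h ▸ h1⟩
      · exact ⟨_, h ▸ h2⟩

theorem not_noFour_of_true_runs {x : ℕ → Bool} (hx : ¬ UltimatelyPeriodic x) (hrec : RunRec x)
    {p₁ p₂ l₁ l₂ q k : ℕ} (h1 : Run x true p₁ l₁) (h2 : Run x true p₂ l₂) (hl : l₁ < l₂)
    (h3 : Run x false q k) (hk : 2 ≤ k) : ¬ NoFour x := by
  intro h4
  by_cases hall : ∀ p j, Run x false p j → j = k
  · exact not_noFour_of_runs hx hk hl hall
      (fun p j hj => run_true_eq_or h4 h3 hk h1 h2 hl.ne hj) h1.pos h4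
  push Not at hall
  obtain ⟨q', k', h5, hne⟩ := hall
  have hpos := h1.pos
  have key := h4 _ _ _ _ _ _ _ _ _ _ (cls_two_of_run h3) (cls_two_of_run h5)
    (cls_two_of_run' h1) (cls_two_of_run' h2)
  rcases (show (k = 2 ∧ l₁ = 2) ∨ (k = 2 ∧ l₂ = 2) ∨ (k' = 2 ∧ l₁ = 2) ∨ (k' = 2 ∧ l₂ = 2) by
    omega) with ⟨rfl, rfl⟩ | ⟨rfl, rfl⟩ | ⟨rfl, rfl⟩ | ⟨rfl, rfl⟩
  · exact not_noFour_of_two hx hrec h1 h2 (by omega) h3 h5 (by omega) h4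
  · exact not_noFour_of_two hx hrec h2 h1 (by omega) h3 h5 (by omega) h4
  · exact not_noFour_of_two hx hrec h1 h2 (by omega) h5 h3 (by omega) h4
  · exact not_noFour_of_two hx hrec h2 h1 (by omega) h5 h3 (by omega) h4

theorem not_noFour_of_long_runs {x : ℕ → Bool} (hx : ¬ UltimatelyPeriodic x) (hrec : RunRec x)
    (hlong : ∀ b, ∃ p k, 2 ≤ k ∧ Run x b p k) : ¬ NoFour x := by
  obtain ⟨b, p, k, q, l, hkl, h1, h2⟩ := exists_two_runs hx
  obtain ⟨r, m, hm, h3⟩ := hlong (!b)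
  cases b
  · exact fun h4 => not_noFour_of_true_runs (fun h => hx h.compl) hrec.compl h1.to_compl h2.to_compl
      hkl h3.to_compl hm h4.compl
  · exact not_noFour_of_true_runs hx hrec h1 h2 hkl h3 hm

/-- A factor `bb` lies in a run of length at least two. -/
theorem exists_long_run {w : ℕ → Bool} (hrec : Recurrent w) (hx : ¬ UltimatelyPeriodic w) {b : Bool}
    (h : IsFactor w [b, b]) : ∃ p k, 2 ≤ k ∧ Run w b p k := by
  obtain ⟨q, -, hq⟩ := exists_ge_eq hx (!b) 0
  obtain ⟨j, hj, e⟩ := hrec _ h (q + 1)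
  obtain ⟨ha, hb⟩ : w j = b ∧ w (j + 1) = b := by
    simpa [factorAt, List.range_succ] using e
  classical
  set p := Nat.findGreatest (fun i => w i = !b) j with hp
  have hpj : p ≤ j := Nat.findGreatest_le j
  have hwp : w p = !b := Nat.findGreatest_spec (P := fun i => w i = !b) (by omega : q ≤ j) hq
  have hne : p ≠ j := by
    intro h; rw [h, ha] at hwp; cases b <;> simp at hwp
  have hgt : ∀ i, p < i → i ≤ j → w i = b := by
    intro i h1 h2
    have := Nat.findGreatest_is_greatest (P := fun i => w i = !b) h1 h2
    revert this
    cases w i <;> cases b <;> simp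
  obtain ⟨k, hk⟩ := exists_run_of hx hwp (hgt _ (by omega) (by omega))
  refine ⟨p, k, ?_, hk⟩
  by_contra hlt
  have hk1 : k = 1 := by have := hk.pos; omega
  have h2 := hk.at_end (q := p + 2) (by omega)
  have h3 : w (p + 2) = b := by
    rcases (show p + 2 ≤ j ∨ p + 2 = j + 1 by omega) with h | h
    · exact hgt _ (by omega) h
    · rw [h, hb]
  rw [h3] at h2
  cases b <;> simp at h2

/-- If each factor of an aperiodic recurrent infinite binary word `w` has
at most three abelian returns, then one of the two letters is isolated in `w`:
either `00` or `11` is not a factor of `w`. -/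
theorem isolated_letter_of_at_most_three_abelian_returns
    (w : ℕ → Bool) (hap : Aperiodic w) (hrec : Recurrent w)
    (h : ∀ u : List Bool, IsFactor w u → (abelianReturnClasses w u).encard ≤ 3) :
    ¬ IsFactor w [false, false] ∨ ¬ IsFactor w [true, true] := by
  by_contra! hc
  have hx := hrec.not_ultimatelyPeriodic hap
  refine not_noFour_of_long_runs hx hrec.runRec ?_ (noFour_of_encard_le h)
  rintro (_ | _)
  · exact exists_long_run hrec hx hc.1
  · exact exists_long_run hrec hx hc.2
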